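/- arXiv:1907.06688 — 2 statements merged into one kernel-verified Lean document; each statement's English description precedes it below -/
import Mathlib

section
/- Let (T, f) be a depth-decomposition of a vector matroid M = (X, I) of depth d. Then there exists an extended depth-decomposition (T', f', g) of M such that the depth of T' is at most d. -/
/-! Infrastructure: rooted trees, depth-decompositions and branch-depth of matroids,
following the definitions of Kardoš, Král', Liebenau, Mach and of the paper
"Optimal matrix tree-depth and a row-invariant parameterized algorithm for
integer programming". -/

/-- A rooted tree on a (nonempty) finite vertex type `V`, given by its root and its
parent function: the parent of the root is the root itself, and from any vertex the
root is reached by iterating the parent function. -/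
structure RTree (V : Type) [Fintype V] [DecidableEq V] where
  root : V
  parent : V → V
  parent_root : parent root = root
  reach : ∀ v : V, ∃ n : ℕ, parent^[n] v = root

namespace RTree

variable {V : Type} [Fintype V] [DecidableEq V]

/-- A vertex is a leaf if it has no children. -/
def IsLeaf (T : RTree V) (v : V) : Prop :=
  ∀ u : V, T.parent u = v → u = v

/-- The non-root vertices on the path from `v` to the root of `T`; they are in bijective
correspondence with the edges of this path (each such vertex corresponds to the edge
joining it to its parent). -/
def pathEdges (T : RTree V) (v : V) : Set V :=
  {u | u ≠ T.root ∧ ∃ n : ℕ, T.parent^[n] v = u}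

/-- The number of edges of the tree. -/
def edgeCount (T : RTree V) : ℕ := Fintype.card V - 1

/-- The depth of a vertex: the number of edges on the path from the root to it. -/
noncomputable def depthV (T : RTree V) (v : V) : ℕ :=
  sInf {n : ℕ | T.parent^[n] v = T.root}

/-- The depth of the tree: the maximum number of edges on a path from the root to a leaf. -/
noncomputable def depth (T : RTree V) : ℕ :=
  Finset.univ.sup T.depthV

/-- The descendants of a vertex `u` (including `u` itself). -/
def desc (T : RTree V) (u : V) : Set V := {w | ∃ n : ℕ, T.parent^[n] w = u}

/-- The number of children of a vertex. -/
noncomputable def childCount (T : RTree V) (u : V) : ℕ :=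
  {w : V | T.parent w = u ∧ w ≠ u}.ncard

/-- A rooted tree is a rooted path if every vertex has at most one child. -/
def IsRootedPath (T : RTree V) : Prop := ∀ u : V, T.childCount u ≤ 1

/-- `a` is a strict ancestor of `v`. -/
def IsStrictAncestor (T : RTree V) (a v : V) : Prop :=
  a ≠ v ∧ ∃ n : ℕ, T.parent^[n] v = a

/-- A branch of `T` consists of a vertex `u`, exactly one child `u'` of `u` and all
descendants of `u'`; it is hence determined by the non-root vertex `u'` and denoted
here by `u'`.  Its root is `parent u'`, its vertex set is `{parent u'} ∪ desc u'`, and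
its edge number `‖S‖` is `(desc u').ncard`.  The branch determined by `u'` is primary
if its root has at least two children and every (strict) ancestor of its root has
exactly one child. -/
def IsPrimaryBranch (T : RTree V) (u' : V) : Prop :=
  u' ≠ T.root ∧ 2 ≤ T.childCount (T.parent u') ∧
    ∀ a : V, T.IsStrictAncestor a (T.parent u') → T.childCount a = 1

end RTree

/-- `(T, f)` is a depth-decomposition of the matroid on ground set `X` with rank
function `rk` and rank `r`: `f` maps elements of the matroid to leaves of `T`, the
number of edges of `T` equals the rank `r` of the matroid, and the rank of every
`X' ⊆ X` is at most the number of edges contained in the union of the paths in `T`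
from the root to the vertices `f x`, `x ∈ X'`. -/
def IsDepthDecompOn {X V : Type} [Fintype V] [DecidableEq V]
    (rk : Set X → ℕ) (r : ℕ) (T : RTree V) (f : X → V) : Prop :=
  (∀ x : X, T.IsLeaf (f x)) ∧ T.edgeCount = r ∧
    ∀ X' : Set X, rk X' ≤ (⋃ x ∈ X', T.pathEdges (f x)).ncard

/-- The branch-depth of the matroid on ground set `X` with rank function `rk` and
rank `r`: the smallest depth of a rooted tree forming a depth-decomposition. -/
noncomputable def branchDepth {X : Type} (rk : Set X → ℕ) (r : ℕ) : ℕ :=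
  sInf {d : ℕ | ∃ (nV : ℕ) (T : RTree (Fin (nV + 1))) (f : X → Fin (nV + 1)),
    IsDepthDecompOn rk r T f ∧ T.depth = d}

/-- The branch of `T` determined by the non-root vertex `u'` is at capacity: the rank
of the set `Ŝ` of matroid elements mapped by `f` to the leaves of the branch equals the
number `‖S‖` of edges of the branch plus the number of edges on the path from the root
of `T` to the root of the branch. -/
def AtCapacity {X V : Type} [Fintype V] [DecidableEq V]
    (rk : Set X → ℕ) (T : RTree V) (f : X → V) (u' : V) : Prop :=
  rk {x | f x ∈ T.desc u'} = (T.desc u').ncard + T.depthV (T.parent u')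

/-- The rank function of the vector matroid formed by the family of vectors `v`:
the rank of a subset is the dimension of its linear hull. -/
noncomputable def vecRk (F : Type) {W ι : Type} [Field F] [AddCommGroup W] [Module F W]
    (v : ι → W) (S : Set ι) : ℕ :=
  Module.finrank F (Submodule.span F (v '' S))

/-- `(T, f, g)` is an extended depth-decomposition of the vector matroid formed by the
family of vectors `v`: `(T, f)` is a depth-decomposition, the images under `g` of the
non-root vertices of `T` form a basis of the linear hull of the vectors, and every
vector `v x` lies in the linear hull of the `g`-image of the non-root vertices on the
path from `f x` to the root. -/
def IsExtDepthDecomp (F : Type) {W ι V : Type} [Field F] [AddCommGroup W] [Module F W]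
    [Fintype V] [DecidableEq V] (v : ι → W) (T : RTree V) (f : ι → V) (g : V → W) : Prop :=
  IsDepthDecompOn (vecRk F v) (vecRk F v Set.univ) T f ∧
  LinearIndependent F (fun u : {u : V // u ≠ T.root} => g u.val) ∧
  Submodule.span F (g '' {u : V | u ≠ T.root}) = Submodule.span F (Set.range v) ∧
  ∀ x : ι, v x ∈ Submodule.span F (g '' T.pathEdges (f x))

/-- `par` is the parent function of a tree rooted at `root`, with heights bounded by `ℓ`. -/
structure IsRanked {V : Type} (root : V) (ℓ : V → ℕ) (par : V → V) : Prop where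
  par_root : par root = root
  lt : ∀ v, v ≠ root → ℓ (par v) < ℓ v

/-- `a` is an ancestor of `w`, or `w` itself. -/
def Anc {V : Type} (par : V → V) (a w : V) : Prop := ∃ n : ℕ, par^[n] w = a

section Anc

variable {V : Type} {root : V} {ℓ : V → ℕ} {par : V → V} {a b w : V}

lemma Anc.refl (w : V) : Anc par w w := ⟨0, rfl⟩

lemma Anc.parent (w : V) : Anc par (par w) w := ⟨1, rfl⟩

lemma Anc.trans (h : Anc par a b) (h' : Anc par b w) : Anc par a w := by
  obtain ⟨n, rfl⟩ := h
  obtain ⟨m, rfl⟩ := h'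
  exact ⟨n + m, Function.iterate_add_apply par n m w⟩

lemma Anc.eq_or (h : Anc par a w) : a = w ∨ Anc par a (par w) := by
  obtain ⟨n, rfl⟩ := h
  cases n with
  | zero => exact Or.inl rfl
  | succ n => exact Or.inr ⟨n, rfl⟩

lemma Anc.total (h : Anc par a w) (h' : Anc par b w) : Anc par a b ∨ Anc par b a := by
  obtain ⟨n, rfl⟩ := h
  obtain ⟨m, rfl⟩ := h'
  rcases le_total n m with hnm | hnm
  · obtain ⟨k, rfl⟩ := Nat.exists_eq_add_of_le' hnm
    exact Or.inr ⟨k, (Function.iterate_add_apply par k n w).symm⟩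
  · obtain ⟨k, rfl⟩ := Nat.exists_eq_add_of_le' hnm
    exact Or.inl ⟨k, (Function.iterate_add_apply par k m w).symm⟩

lemma Anc.eq_or_child (h : Anc par a w) : w = a ∨ ∃ y, par y = a ∧ Anc par y w := by
  obtain ⟨n, rfl⟩ := h
  cases n with
  | zero => exact Or.inl rfl
  | succ n => exact Or.inr ⟨par^[n] w, (Function.iterate_succ_apply' par n w).symm, n, rfl⟩

lemma IsRanked.le_of_anc (h : IsRanked root ℓ par) (haw : Anc par a w) : ℓ a ≤ ℓ w := by
  obtain ⟨n, rfl⟩ := haw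
  induction n with
  | zero => exact le_rfl
  | succ n ih =>
    rw [Function.iterate_succ_apply']
    by_cases hr : par^[n] w = root
    · rw [hr, h.par_root, ← hr]
      exact ih
    · exact (h.lt _ hr).le.trans ih

lemma IsRanked.eq_root_of_anc (h : IsRanked root ℓ par) (haw : Anc par a root) : a = root := by
  obtain ⟨n, rfl⟩ := haw
  exact Function.iterate_fixed h.par_root n

lemma IsRanked.not_anc_parent (h : IsRanked root ℓ par) (hw : w ≠ root) :
    ¬ Anc par w (par w) := fun hc => by
  have h1 := h.lt w hw
  have h2 := h.le_of_anc hc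
  omega

lemma IsRanked.iterate_eq_root (h : IsRanked root ℓ par) (n : ℕ) :
    ∀ w, ℓ w ≤ n → par^[n] w = root := by
  induction n with
  | zero =>
    intro w hw
    by_contra hr
    have := h.lt w hr
    omega
  | succ n ih =>
    intro w hw
    by_cases hr : w = root
    · rw [hr]
      exact Function.iterate_fixed h.par_root _
    · exact ih _ (by have := h.lt w hr; omega)

lemma IsRanked.anc_root (h : IsRanked root ℓ par) (w : V) : Anc par root w :=
  ⟨ℓ w, h.iterate_eq_root _ w le_rfl⟩

end Anc

section Closed

variable {V : Type} [Fintype V] [DecidableEq V]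

/-- A vertex set containing the root and closed under taking parents: the vertex set of a
subtree sharing the root. -/
def IsRootedSubtree (root : V) (par : V → V) (U : Finset V) : Prop :=
  root ∈ U ∧ ∀ w ∈ U, par w ∈ U

open Classical in
/-- The vertices on the path from `w` to the root. -/
noncomputable def up (par : V → V) (w : V) : Finset V := Finset.univ.filter fun a => Anc par a w

open Classical in
/-- The descendants of `a`, including `a`. -/
noncomputable def down (par : V → V) (a : V) : Finset V := Finset.univ.filter fun w => Anc par a w

variable {root : V} {ℓ : V → ℕ} {par : V → V} {a w : V} {U U' : Finset V}

omit [DecidableEq V] in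
@[simp] lemma mem_up : a ∈ up par w ↔ Anc par a w := by simp [up]

omit [DecidableEq V] in
@[simp] lemma mem_down : w ∈ down par a ↔ Anc par a w := by simp [down]

omit [Fintype V] [DecidableEq V] in
lemma IsRootedSubtree.mem_of_anc (h : IsRootedSubtree root par U) (haw : Anc par a w)
    (hw : w ∈ U) : a ∈ U := by
  obtain ⟨n, rfl⟩ := haw
  induction n with
  | zero => exact hw
  | succ n ih =>
    rw [Function.iterate_succ_apply']
    exact h.2 _ ih

omit [DecidableEq V] in
lemma IsRootedSubtree.up_subset (h : IsRootedSubtree root par U) (hw : w ∈ U) :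
    up par w ⊆ U := fun _ ha => h.mem_of_anc (mem_up.1 ha) hw

omit [DecidableEq V] in
lemma IsRootedSubtree.disjoint_down (h : IsRootedSubtree root par U) (hw : w ∉ U) :
    Disjoint U (down par w) :=
  Finset.disjoint_left.2 fun _ hx hd => hw (h.mem_of_anc (mem_down.1 hd) hx)

omit [Fintype V] in
lemma IsRootedSubtree.union (h : IsRootedSubtree root par U) (h' : IsRootedSubtree root par U') :
    IsRootedSubtree root par (U ∪ U') := by
  obtain ⟨h1, h2⟩ := h
  obtain ⟨h3, h4⟩ := h'
  refine ⟨by simp [h1], fun w hw => ?_⟩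
  simp only [Finset.mem_union] at hw ⊢
  exact hw.imp (h2 w) (h4 w)

omit [Fintype V] in
lemma IsRootedSubtree.inter (h : IsRootedSubtree root par U) (h' : IsRootedSubtree root par U') :
    IsRootedSubtree root par (U ∩ U') := by
  obtain ⟨h1, h2⟩ := h
  obtain ⟨h3, h4⟩ := h'
  refine ⟨by simp [h1, h3], fun w hw => ?_⟩
  simp only [Finset.mem_inter] at hw ⊢
  exact hw.imp (h2 w) (h4 w)

omit [DecidableEq V] in
lemma isRootedSubtree_univ : IsRootedSubtree root par (Finset.univ : Finset V) := by
  simp [IsRootedSubtree]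

omit [DecidableEq V] in
lemma IsRanked.isRootedSubtree_up (h : IsRanked root ℓ par) (w : V) :
    IsRootedSubtree root par (up par w) :=
  ⟨mem_up.2 (h.anc_root w), fun x hx => mem_up.2 ((Anc.parent x).trans (mem_up.1 hx))⟩

lemma IsRanked.isRootedSubtree_sdiff (h : IsRanked root ℓ par) (ha : a ≠ root)
    (hU : IsRootedSubtree root par U) : IsRootedSubtree root par (U \ down par a) := by
  refine ⟨?_, fun x hx => ?_⟩
  · simp only [Finset.mem_sdiff, mem_down]
    exact ⟨hU.1, fun hc => ha (h.eq_root_of_anc hc)⟩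
  · simp only [Finset.mem_sdiff, mem_down] at hx ⊢
    exact ⟨hU.2 x hx.1, fun hc => hx.2 (hc.trans (Anc.parent x))⟩

lemma IsRanked.isRootedSubtree_compl (h : IsRanked root ℓ par) (ha : a ≠ root) :
    IsRootedSubtree root par (down par a)ᶜ := by
  rw [Finset.compl_eq_univ_sdiff]
  exact h.isRootedSubtree_sdiff ha isRootedSubtree_univ

lemma IsRootedSubtree.union_down (hU : IsRootedSubtree root par U) (ha : par a ∈ U) :
    IsRootedSubtree root par (U ∪ down par a) := by
  refine ⟨by simp [hU.1], fun x hx => ?_⟩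
  simp only [Finset.mem_union, mem_down] at hx ⊢
  rcases hx with hx | hx
  · exact Or.inl (hU.2 x hx)
  · rcases hx.eq_or with rfl | hx
    · exact Or.inl ha
    · exact Or.inr hx

lemma up_eq_insert (w : V) : up par w = insert w (up par (par w)) := by
  ext x
  simp only [mem_up, Finset.mem_insert]
  constructor
  · exact Anc.eq_or
  · rintro (rfl | hx)
    · exact Anc.refl _
    · exact hx.trans (Anc.parent w)

lemma IsRanked.card_up (h : IsRanked root ℓ par) (hw : w ≠ root) :
    (up par w).card = (up par (par w)).card + 1 := by
  rw [up_eq_insert w, Finset.card_insert_of_notMem]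
  rw [mem_up]
  exact h.not_anc_parent hw

omit [DecidableEq V] in
lemma IsRanked.up_root (h : IsRanked root ℓ par) : up par root = {root} := by
  ext x
  simp only [mem_up, Finset.mem_singleton]
  exact ⟨h.eq_root_of_anc, fun hx => hx ▸ Anc.refl _⟩

end Closed

section Valid

open Module

variable {F W V : Type} [Field F] [AddCommGroup W] [Module F W] [FiniteDimensional F W]
  [Fintype V] [DecidableEq V] {root : V} {ℓ : V → ℕ} {par : V → V} {A : V → Submodule F W}

/-- Every rooted subtree has at least as many edges as the dimension of the subspaces assigned
to its vertices. -/
def IsValid (root : V) (par : V → V) (A : V → Submodule F W) : Prop :=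
  ∀ U, IsRootedSubtree root par U → finrank F ↥(U.sup A) + 1 ≤ U.card

/-- A rooted subtree whose number of edges is the dimension of the subspaces assigned to it. -/
def IsTight (root : V) (par : V → V) (A : V → Submodule F W) (U : Finset V) : Prop :=
  IsRootedSubtree root par U ∧ finrank F ↥(U.sup A) + 1 = U.card

omit [FiniteDimensional F W] [Fintype V] [DecidableEq V] in
lemma IsValid.isTight (h : IsValid root par A) {U : Finset V} (hU : IsRootedSubtree root par U)
    (hc : U.card ≤ finrank F ↥(U.sup A) + 1) : IsTight root par A U :=
  ⟨hU, le_antisymm (h U hU) hc⟩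

omit [Fintype V] in
/-- If the union and the intersection of two rooted subtrees are tight, then so is the first. -/
lemma IsValid.isTight_of_union_inter (h : IsValid root par A) {U U' : Finset V}
    (hU : IsRootedSubtree root par U) (hU' : IsRootedSubtree root par U')
    (h1 : IsTight root par A (U ∪ U')) (h2 : IsTight root par A (U ∩ U')) :
    IsTight root par A U := by
  refine h.isTight hU ?_
  have e1 := h1.2
  have e2 := h2.2
  have e3 := h U' hU'
  have e4 := Finset.card_union_add_card_inter U U'
  have e5 := Submodule.finrank_sup_add_finrank_inf_eq (U.sup A) (U'.sup A)
  rw [← Finset.sup_union] at e5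
  have e6 : finrank F ↥((U ∩ U').sup A) ≤ finrank F ↥(U.sup A ⊓ U'.sup A) :=
    Submodule.finrank_mono (le_inf (Finset.sup_mono Finset.inter_subset_left)
      (Finset.sup_mono Finset.inter_subset_right))
  omega

/-- A valid assignment of subspaces to the vertices of a tree that can be improved neither by
enlarging a subspace nor by attaching a vertex to its grandparent. -/
structure IsExtremal (root : V) (ℓ : V → ℕ) (par : V → V) (A : V → Submodule F W) : Prop where
  ranked : IsRanked root ℓ par
  valid : IsValid root par A
  total : IsTight root par A Finset.univ
  mem_of_tight : ∀ u w, (∀ U, IsTight root par A U → u ∈ U → w ∈ U.sup A) → w ∈ A u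
  not_valid_update : ∀ y, y ≠ root → par y ≠ root →
    ¬ IsValid root (Function.update par y (par (par y))) A

namespace IsExtremal

variable (h : IsExtremal root ℓ par A)
include h

omit [FiniteDimensional F W] in
lemma mono_parent (u : V) : A (par u) ≤ A u := fun w hw =>
  h.mem_of_tight u w fun _ hU hu => Finset.le_sup (f := A) (hU.1.2 u hu) hw

omit [FiniteDimensional F W] in
lemma mono {a w : V} (haw : Anc par a w) : A a ≤ A w := by
  obtain ⟨n, rfl⟩ := haw
  induction n with
  | zero => exact le_rfl
  | succ n ih =>
    rw [Function.iterate_succ_apply']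
    exact (h.mono_parent _).trans ih

omit [FiniteDimensional F W] in
lemma sup_up (w : V) : (up par w).sup A = A w :=
  le_antisymm (Finset.sup_le fun _ ha => h.mono (mem_up.1 ha))
    (Finset.le_sup (f := A) (mem_up.2 (Anc.refl w)))

omit [FiniteDimensional F W] in
lemma finrank_le (w : V) : finrank F ↥(A w) + 1 ≤ (up par w).card := by
  have := h.valid _ (h.ranked.isRootedSubtree_up w)
  rwa [h.sup_up] at this

/-- Attaching `y` to its grandparent violates validity on some subtree, which yields a tight
subtree meeting the branches below the parent of `y` only in the branch of `y`. -/
lemma exists_tight_of_child {y z : V} (hyz : par y = z) (hy : y ≠ root) (hz : z ≠ root) :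
    ∃ U, IsTight root par A U ∧ y ∈ U ∧ ∀ w ∈ U, Anc par z w → w = z ∨ Anc par y w := by
  subst hyz
  have hyz : par y ≠ y := fun hc => by
    have := h.ranked.lt y hy
    rw [hc] at this
    omega
  have hn := h.not_valid_update y hy hz
  unfold IsValid at hn
  push Not at hn
  obtain ⟨U, ⟨hr, hU⟩, hlt⟩ := hn
  have hU' : ∀ w ∈ U, w ≠ y → par w ∈ U := fun w hw hwy => by
    have := hU w hw
    rwa [Function.update_of_ne hwy] at this
  by_cases hcl : IsRootedSubtree root par U
  · have := h.valid U hcl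
    omega
  have hyU : y ∈ U := by
    by_contra hyU
    exact hcl ⟨hr, fun w hw => hU' w hw fun hc => hyU (hc ▸ hw)⟩
  have hzU : par y ∉ U := fun hzU =>
    hcl ⟨hr, fun w hw => if hwy : w = y then hwy ▸ hzU else hU' w hw hwy⟩
  have hppU : par (par y) ∈ U := by
    have := hU y hyU
    rwa [Function.update_self] at this
  have hcl' : IsRootedSubtree root par (insert (par y) U) := by
    refine ⟨Finset.mem_insert_of_mem hr, fun w hw => ?_⟩
    rcases Finset.mem_insert.1 hw with rfl | hw
    · exact Finset.mem_insert_of_mem hppU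
    · by_cases hwy : w = y
      · rw [hwy]
        exact Finset.mem_insert_self _ _
      · exact Finset.mem_insert_of_mem (hU' w hw hwy)
  refine ⟨insert (par y) U, h.valid.isTight hcl' ?_, Finset.mem_insert_of_mem hyU, ?_⟩
  · rw [Finset.card_insert_of_notMem hzU]
    have : finrank F ↥(U.sup A) ≤ finrank F ↥((insert (par y) U).sup A) :=
      Submodule.finrank_mono (Finset.sup_mono (Finset.subset_insert _ _))
    omega
  · intro w hw hzw
    rcases hzw.eq_or_child with rfl | ⟨y', hy', hy'w⟩
    · exact Or.inl rfl
    · by_cases hyy : y' = y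
      · exact Or.inr (hyy ▸ hy'w)
      · exfalso
        have hmem := hcl'.mem_of_anc hy'w hw
        rcases Finset.mem_insert.1 hmem with hc | hmem
        · have := h.ranked.lt (par y) hz
          rw [← hc, hy'] at this
          rw [hc] at this
          omega
        · exact hzU (hy' ▸ hU' y' hmem hyy)

/-- The branch at `u` together with the path above it is tight if that path is. -/
lemma isTight_up_union_down {u : V} (hu : u ≠ root)
    (hp : finrank F ↥(A (par u)) + 1 = (up par (par u)).card) :
    IsTight root par A (up par (par u) ∪ down par u) := by
  have hpu : Disjoint (up par (par u)) (down par u) :=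
    (h.ranked.isRootedSubtree_up _).disjoint_down fun hc =>
      h.ranked.not_anc_parent hu (mem_up.1 hc)
  refine h.valid.isTight_of_union_inter (U' := (down par u)ᶜ)
    ((h.ranked.isRootedSubtree_up _).union_down (mem_up.2 (Anc.refl _)))
    (h.ranked.isRootedSubtree_compl hu) ?_ ?_
  · convert h.total using 1
    ext x
    simp only [Finset.mem_union, Finset.mem_compl, Finset.mem_univ, iff_true]
    tauto
  · have : (up par (par u) ∪ down par u) ∩ (down par u)ᶜ = up par (par u) := by
      ext x
      have : x ∈ up par (par u) → x ∉ down par u := fun hx => Finset.disjoint_left.1 hpu hx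
      simp only [Finset.mem_union, Finset.mem_inter, Finset.mem_compl]
      tauto
    rw [this]
    exact ⟨h.ranked.isRootedSubtree_up _, by rw [h.sup_up, hp]⟩

/-- A tight subtree cannot end on a path along which the subspaces do not grow. -/
lemma not_isTight_of_le {u z : V} (hu : u ≠ root) (huz : Anc par u z)
    (hz : A z ≤ A (par u)) {U : Finset V} (hzU : z ∈ U)
    (hU : ∀ w ∈ U, Anc par u w → Anc par w z) : ¬ IsTight root par A U := fun ht => by
  have h1 := h.valid _ (h.ranked.isRootedSubtree_sdiff hu ht.1)
  have h2 : U.sup A ≤ (U \ down par u).sup A := by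
    refine Finset.sup_le fun w hw => ?_
    by_cases hwu : Anc par u w
    · refine ((h.mono (hU w hw hwu)).trans hz).trans (Finset.le_sup (f := A) ?_)
      simp only [Finset.mem_sdiff, mem_down]
      exact ⟨ht.1.mem_of_anc ((Anc.parent u).trans huz) hzU, h.ranked.not_anc_parent hu⟩
    · exact Finset.le_sup (f := A) (by simp [hw, hwu])
  have h3 := Submodule.finrank_mono h2
  have h4 : (U \ down par u).card < U.card :=
    Finset.card_lt_card ((Finset.ssubset_iff_of_subset Finset.sdiff_subset).2
      ⟨z, hzU, by simp [huz]⟩)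
  have h5 := ht.2
  omega

lemma isTight_up_union_down_child {u z y : V} (hu : u ≠ root)
    (hp : finrank F ↥(A (par u)) + 1 = (up par (par u)).card) (huz : Anc par u z)
    (hcomp : ∀ w, Anc par u w → Anc par z w ∨ Anc par w z) (hyz : par y = z) (hy : y ≠ root)
    (hz : z ≠ root) : IsTight root par A (up par z ∪ down par y) := by
  have hup := h.ranked.isRootedSubtree_up z
  have hyz' : ¬ Anc par y z := hyz ▸ h.ranked.not_anc_parent hy
  obtain ⟨U, hU, hyU, hUy⟩ := h.exists_tight_of_child hyz hy hz
  have hzU : z ∈ U := hyz ▸ hU.1.2 y hyU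
  have hpU : up par z ⊆ U := hU.1.up_subset hzU
  have hY : IsTight root par A (U ∪ down par y) := by
    refine h.valid.isTight_of_union_inter (U' := U ∪ (down par y)ᶜ)
      (hU.1.union_down (hyz ▸ hzU)) (hU.1.union (h.ranked.isRootedSubtree_compl hy)) ?_ ?_
    · convert h.total using 1
      ext x
      simp only [Finset.mem_union, Finset.mem_compl, Finset.mem_univ, iff_true]
      tauto
    · convert hU using 1
      ext x
      simp only [Finset.mem_union, Finset.mem_inter, Finset.mem_compl]
      tauto
  have hout := h.ranked.isRootedSubtree_sdiff hu hU.1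
  have hunion : (U \ down par u) ∪ (up par z ∪ down par y) = U ∪ down par y := by
    ext w
    have h1 : Anc par w z → w ∈ U := fun hw => hpU (mem_up.2 hw)
    have h2 : w ∈ U → Anc par u w → Anc par w z ∨ Anc par y w := fun hw huw => by
      rcases hcomp w huw with hc | hc
      · rcases hUy w hw hc with rfl | hc
        · exact Or.inl (Anc.refl _)
        · exact Or.inr hc
      · exact Or.inl hc
    simp only [Finset.mem_union, Finset.mem_sdiff, mem_down, mem_up]
    tauto
  have hinter : (U \ down par u) ∩ (up par z ∪ down par y) = up par (par u) := by
    ext w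
    have h1 : Anc par y w → Anc par u w := fun hw =>
      (huz.trans (hyz ▸ Anc.parent y)).trans hw
    have h2 : Anc par w z → ¬ Anc par u w → Anc par w (par u) := fun hw huw => by
      rcases hw.total huz with hc | hc
      · rcases hc.eq_or with rfl | hc
        · exact absurd (Anc.refl _) huw
        · exact hc
      · exact absurd hc huw
    have h3 : Anc par w (par u) → Anc par w z := fun hw => (hw.trans (Anc.parent u)).trans huz
    have h4 : Anc par w (par u) → ¬ Anc par u w := fun hw hc =>
      h.ranked.not_anc_parent hu (hc.trans hw)
    have h5 : Anc par w z → w ∈ U := fun hw => hpU (mem_up.2 hw)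
    simp only [Finset.mem_union, Finset.mem_inter, Finset.mem_sdiff, mem_down, mem_up]
    tauto
  refine h.valid.isTight (hup.union_down (hyz ▸ mem_up.2 (Anc.refl _))) ?_
  have e1 := Finset.card_union_add_card_inter (U \ down par u) (up par z ∪ down par y)
  have e2 := Submodule.finrank_sup_add_finrank_inf_eq ((U \ down par u).sup A)
    ((up par z ∪ down par y).sup A)
  rw [← Finset.sup_union, hunion] at e2
  rw [hunion, hinter] at e1
  have e3 : finrank F ↥(A (par u)) ≤
      finrank F ↥((U \ down par u).sup A ⊓ (up par z ∪ down par y).sup A) := by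
    have hmem : par u ∈ (U \ down par u) ∩ (up par z ∪ down par y) :=
      hinter ▸ mem_up.2 (Anc.refl _)
    rw [Finset.mem_inter] at hmem
    exact Submodule.finrank_mono
      (le_inf (Finset.le_sup (f := A) hmem.1) (Finset.le_sup (f := A) hmem.2))
  have e4 := h.valid _ hout
  have e5 := hY.2
  omega

/-- If the branches at all children of `z`, together with the path to the root, are tight, and
there are at least two of them, then the subspace of `z` has full dimension. -/
lemma card_up_le_of_children {z y₁ y₂ : V} (h₁ : par y₁ = z) (h₂ : par y₂ = z) (hne : y₁ ≠ y₂)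
    (hz : z ≠ root)
    (hQ : ∀ y, par y = z → IsTight root par A (up par z ∪ down par y)) :
    (up par z).card ≤ finrank F ↥(A z) + 1 := by
  have hroot : ∀ y, par y = z → y ≠ root := fun y hy hc => hz (by rw [← hy, hc, h.ranked.par_root])
  have hzmem : z ∈ up par z := mem_up.2 (Anc.refl z)
  have hdisj : ∀ y, par y = z → ∀ U, IsRootedSubtree root par U → y ∉ U →
      (U ∪ down par y).card = U.card + (down par y).card := fun y _ U hU hyU =>
    Finset.card_union_of_disjoint (hU.disjoint_down hyU)
  have hyz : ∀ y, par y = z → y ∉ up par z := fun y hy hc =>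
    h.ranked.not_anc_parent (hroot y hy) (hy ▸ mem_up.1 hc)
  have hQc : ∀ y, par y = z →
      finrank F ↥((up par z ∪ down par y).sup A) + 1 = (up par z).card + (down par y).card :=
    fun y hy => by
      rw [(hQ y hy).2, hdisj y hy _ (h.ranked.isRootedSubtree_up z) (hyz y hy)]
  have hsib : ∀ y y', par y = z → par y' = z → y ≠ y' → ¬ Anc par y y' :=
      fun y y' hy hy' hn hc => by
    rcases hc.eq_or with hc | hc
    · exact hn hc
    · rw [hy', ← hy] at hc
      exact h.ranked.not_anc_parent (hroot y hy) hc
  set N : V → Submodule F W := fun y => (up par z ∪ down par y).sup A ⊓ ((down par y)ᶜ).sup A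
    with hN
  have hNle : ∀ y, par y = z → finrank F ↥(N y) + 1 ≤ (up par z).card := fun y hy => by
    have e1 := Submodule.finrank_sup_add_finrank_inf_eq ((up par z ∪ down par y).sup A)
      (((down par y)ᶜ).sup A)
    have e2 : (up par z ∪ down par y) ∪ (down par y)ᶜ = Finset.univ := by
      ext x
      simp only [Finset.mem_union, Finset.mem_compl, Finset.mem_univ, iff_true]
      tauto
    rw [← Finset.sup_union, e2] at e1
    have e3 := h.total.2
    have e4 := h.valid _ (h.ranked.isRootedSubtree_compl (hroot y hy))
    have e5 := hQc y hy
    have e6 := Finset.card_add_card_compl (down par y)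
    rw [← Finset.card_univ] at e6
    change finrank F ↥(_ ⊓ _ : Submodule F W) + 1 ≤ _
    omega
  have hMge : ∀ y y', par y = z → par y' = z → y ≠ y' → (up par z).card ≤
      finrank F ↥((up par z ∪ down par y).sup A ⊓ (up par z ∪ down par y').sup A) + 1 :=
    fun y y' hy hy' hn => by
      have e1 := Submodule.finrank_sup_add_finrank_inf_eq ((up par z ∪ down par y).sup A)
        ((up par z ∪ down par y').sup A)
      have e2 : (up par z ∪ down par y) ∪ (up par z ∪ down par y') =
          (up par z ∪ down par y) ∪ down par y' := by
        ext x
        simp only [Finset.mem_union]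
        tauto
      rw [← Finset.sup_union, e2] at e1
      have hcl := (hQ y hy).1.union_down (a := y') (by
        rw [hy']
        exact Finset.mem_union_left _ hzmem)
      have e3 := h.valid _ hcl
      rw [hdisj y' hy' _ (hQ y hy).1 (by
        simp only [Finset.mem_union, mem_down, not_or]
        exact ⟨hyz y' hy', hsib y y' hy hy' hn⟩),
        hdisj y hy _ (h.ranked.isRootedSubtree_up z) (hyz y hy)] at e3
      have e4 := hQc y hy
      have e5 := hQc y' hy'
      omega
  have hsub : ∀ y y', par y = z → par y' = z → y ≠ y' →
      (up par z ∪ down par y').sup A ≤ ((down par y)ᶜ).sup A := fun y y' hy hy' hn => by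
    refine Finset.sup_mono fun x hx => ?_
    simp only [Finset.mem_union, mem_down, mem_up, Finset.mem_compl] at hx ⊢
    intro hc
    rcases hx with hx | hx
    · exact hyz y hy (mem_up.2 (hc.trans hx))
    · rcases hc.total hx with hc | hc
      · exact hsib y y' hy hy' hn hc
      · exact hsib y' y hy' hy (Ne.symm hn) hc
  have hMN : ∀ y y', par y = z → par y' = z → y ≠ y' →
      (up par z ∪ down par y).sup A ⊓ (up par z ∪ down par y').sup A = N y :=
    fun y y' hy hy' hn => by
      refine Submodule.eq_of_le_of_finrank_le (inf_le_inf_left _ (hsub y y' hy hy' hn)) ?_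
      have e1 := hNle y hy
      have e2 := hMge y y' hy hy' hn
      omega
  have hNN : ∀ y y', par y = z → par y' = z → N y = N y' := fun y y' hy hy' => by
    by_cases hn : y = y'
    · rw [hn]
    · rw [← hMN y y' hy hy' hn, ← hMN y' y hy' hy (Ne.symm hn), inf_comm]
  have hNcard : (up par z).card ≤ finrank F ↥(N y₁) + 1 := by
    rw [← hMN y₁ y₂ h₁ h₂ hne]
    exact hMge y₁ y₂ h₁ h₂ hne
  have hmiss : ∀ y, par y = z → ∀ U, IsRootedSubtree root par U → z ∈ U → y ∉ U →
      finrank F ↥(U.sup A ⊔ N y₁) + 1 ≤ U.card := fun y hy U hU hzU hyU => by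
    rw [hNN y₁ y h₁ hy]
    have e1 := Submodule.finrank_sup_add_finrank_inf_eq (U.sup A ⊔ N y)
      ((up par z ∪ down par y).sup A)
    have e2 : U ∪ (up par z ∪ down par y) = U ∪ down par y := by
      rw [← Finset.union_assoc, Finset.union_eq_left.2 (hU.up_subset hzU)]
    have e3 : N y ⊔ (up par z ∪ down par y).sup A = (up par z ∪ down par y).sup A :=
      sup_eq_right.2 inf_le_left
    rw [sup_assoc, e3, ← Finset.sup_union, e2] at e1
    have e4 := h.valid _ (hU.union_down (hy ▸ hzU))
    rw [hdisj y hy U hU hyU] at e4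
    have e5 : finrank F ↥((U.sup A ⊔ N y) ⊓ (up par z ∪ down par y).sup A) ≤ finrank F ↥(N y) := by
      refine Submodule.finrank_mono
        (le_inf inf_le_right (inf_le_left.trans (sup_le ?_ inf_le_right)))
      exact Finset.sup_mono fun x hx => Finset.mem_compl.2
        (Finset.disjoint_left.1 (hU.disjoint_down hyU) hx)
    have e6 := hNle y hy
    have e7 := hQc y hy
    omega
  have hle : N y₁ ≤ A z := by
    intro w hw
    refine h.mem_of_tight z w fun U hU hzU => ?_
    have key : finrank F ↥(U.sup A ⊔ N y₁) + 1 ≤ U.card := by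
      have hd := h.ranked.isRootedSubtree_sdiff (hroot y₁ h₁) hU.1
      have hpU := hU.1.up_subset hzU
      have hz1 : ¬ Anc par y₁ z := fun hc => hyz y₁ h₁ (mem_up.2 hc)
      have hi : IsRootedSubtree root par (U ∩ (up par z ∪ down par y₁)) := hU.1.inter (hQ y₁ h₁).1
      have e1 := hmiss y₁ h₁ (U \ down par y₁) hd (by simp [hzU, hz1])
        (by simp [Anc.refl])
      have e2 := hmiss y₂ h₂ (U ∩ (up par z ∪ down par y₁)) hi (by simp [hzU, Anc.refl]) (by
        simp only [Finset.mem_union, Finset.mem_inter, mem_down, not_or, not_and]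
        exact fun _ => ⟨hyz y₂ h₂, hsib y₁ y₂ h₁ h₂ hne⟩)
      have e3 : (U \ down par y₁) ∪ (U ∩ (up par z ∪ down par y₁)) = U := by
        ext x
        simp only [Finset.mem_union, Finset.mem_inter, Finset.mem_sdiff]
        tauto
      have e4 : (U \ down par y₁) ∩ (U ∩ (up par z ∪ down par y₁)) = up par z := by
        ext x
        have h1 := @hpU x
        have h2 : Anc par x z → ¬ Anc par y₁ x := fun hx hc => hz1 (hc.trans hx)
        simp only [Finset.mem_union, Finset.mem_inter, Finset.mem_sdiff, mem_up, mem_down] at h1 ⊢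
        tauto
      have e5 := Finset.card_union_add_card_inter (U \ down par y₁)
        (U ∩ (up par z ∪ down par y₁))
      rw [e3, e4] at e5
      have e6 := Submodule.finrank_sup_add_finrank_inf_eq ((U \ down par y₁).sup A ⊔ N y₁)
        ((U ∩ (up par z ∪ down par y₁)).sup A ⊔ N y₁)
      rw [← sup_sup_distrib_right, ← Finset.sup_union, e3] at e6
      have e7 : finrank F ↥(N y₁) ≤ finrank F ↥(((U \ down par y₁).sup A ⊔ N y₁) ⊓
          ((U ∩ (up par z ∪ down par y₁)).sup A ⊔ N y₁)) :=
        Submodule.finrank_mono (le_inf le_sup_right le_sup_right)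
      omega
    have heq : U.sup A = U.sup A ⊔ N y₁ := by
      refine Submodule.eq_of_le_of_finrank_le le_sup_left ?_
      have := hU.2
      omega
    rw [heq]
    exact (le_sup_right : N y₁ ≤ _) hw
  have := Submodule.finrank_mono hle
  omega

/-- In an extremal assignment, the dimension of the subspace of a vertex is its depth. -/
theorem finrank_add_one_eq_card_up (u : V) : finrank F ↥(A u) + 1 = (up par u).card := by
  induction hn : ℓ u using Nat.strong_induction_on generalizing u with
  | _ n ih =>
  subst hn
  by_cases hu : u = root
  · have h1 := h.finrank_le u
    rw [hu, h.ranked.up_root, Finset.card_singleton] at *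
    omega
  have hp := ih _ (h.ranked.lt u hu) (par u) rfl
  by_contra hne
  have hAu : A u ≤ A (par u) := by
    refine (Submodule.eq_of_le_of_finrank_le (h.mono_parent u) ?_).ge
    have h1 := h.finrank_le u
    have h2 := h.ranked.card_up hu
    omega
  classical
  set Z : Finset V := Finset.univ.filter fun z => Anc par u z ∧
    (∀ w, Anc par u w → Anc par z w ∨ Anc par w z) ∧ A z ≤ A (par u) with hZ
  obtain ⟨z, hzZ, hzmax⟩ := Z.exists_max_image ℓ
    ⟨u, by simpa [hZ, Anc.refl] using ⟨fun w hw => Or.inl hw, hAu⟩⟩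
  obtain ⟨huz, hcomp, hAz⟩ : Anc par u z ∧
    (∀ w, Anc par u w → Anc par z w ∨ Anc par w z) ∧ A z ≤ A (par u) := by simpa [hZ] using hzZ
  have hz : z ≠ root := fun hc => hu (h.ranked.eq_root_of_anc (hc ▸ huz))
  have hroot : ∀ y, par y = z → y ≠ root := fun y hy hc => hz (by rw [← hy, hc, h.ranked.par_root])
  have hleaf : ∃ y, par y = z := by
    by_contra hc
    push Not at hc
    refine h.not_isTight_of_le hu huz hAz (U := up par (par u) ∪ down par u) (by simp [huz])
      (fun w _ huw => ?_) (h.isTight_up_union_down hu hp)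
    rcases hcomp w huw with hw | hw
    · rcases hw.eq_or_child with rfl | ⟨y, hy, -⟩
      · exact Anc.refl _
      · exact absurd hy (hc y)
    · exact hw
  obtain ⟨y, hy⟩ := hleaf
  by_cases hy2 : ∃ y', par y' = z ∧ y ≠ y'
  · obtain ⟨y', hy', hyy⟩ := hy2
    have h1 := h.card_up_le_of_children hy hy' hyy hz fun x hx =>
      h.isTight_up_union_down_child hu hp huz hcomp hx (hroot x hx) hz
    have h2 := Submodule.finrank_mono hAz
    have h3 : (up par (par u)).card < (up par z).card := by
      refine Finset.card_lt_card ((Finset.ssubset_iff_of_subset fun x hx => ?_).2 ⟨u, ?_, ?_⟩)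
      · exact mem_up.2 (((mem_up.1 hx).trans (Anc.parent u)).trans huz)
      · exact mem_up.2 huz
      · rw [mem_up]
        exact h.ranked.not_anc_parent hu
    omega
  · push Not at hy2
    have hzy : Anc par z y := hy ▸ Anc.parent y
    have hdown : ∀ w, Anc par u w → Anc par y w ∨ Anc par w z := fun w huw => by
      rcases hcomp w huw with hw | hw
      · rcases hw.eq_or_child with rfl | ⟨y', hy', hw⟩
        · exact Or.inr (Anc.refl _)
        · exact Or.inl (hy2 y' hy' ▸ hw)
      · exact Or.inr hw
    refine absurd (hzmax y ?_) (not_le.2 (hy ▸ h.ranked.lt y (hroot y hy)))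
    simp only [hZ, Finset.mem_filter, Finset.mem_univ, true_and]
    refine ⟨huz.trans hzy, fun w huw => (hdown w huw).imp_right fun hw => hw.trans hzy, ?_⟩
    refine le_trans (fun x hx => h.mem_of_tight z x fun U hU hzU => ?_) hAz
    by_cases hyU : y ∈ U
    · exact Finset.le_sup (f := A) hyU hx
    · exact absurd hU (h.not_isTight_of_le hu huz hAz hzU fun w hw huw =>
        (hdown w huw).resolve_left fun hc => hyU (hU.1.mem_of_anc hc hw))

end IsExtremal

/-- Every valid assignment whose subspaces span the whole space can be improved to an extremal
one. -/
theorem exists_isExtremal (hr : IsRanked root ℓ par) (hA : IsValid root par A)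
    (ht : IsTight root par A Finset.univ) :
    ∃ (par' : V → V) (A' : V → Submodule F W), IsExtremal root ℓ par' A' ∧ A ≤ A' := by
  let μ : (V → V) × (V → Submodule F W) → ℕ := fun q =>
    (∑ x, ℓ (q.1 x)) + ∑ x, (finrank F W - finrank F ↥(q.2 x))
  obtain ⟨⟨p, B⟩, ⟨h1, h2, h3, h4⟩, hmin⟩ := (measure μ).wf.has_min
    {q | IsRanked root ℓ q.1 ∧ IsValid root q.1 q.2 ∧ IsTight root q.1 q.2 Finset.univ ∧ A ≤ q.2}
    ⟨(par, A), hr, hA, ht, le_rfl⟩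
  dsimp only at h1 h2 h3 h4
  refine ⟨p, B, ⟨h1, h2, h3, fun u w hw => ?_, fun y hy hpy hv => ?_⟩, h4⟩
  · by_contra hwu
    let B' := Function.update B u (B u ⊔ Submodule.span F {w})
    have hB'u : B' u = B u ⊔ Submodule.span F {w} := Function.update_self ..
    have hB' : ∀ x, x ≠ u → B' x = B x := fun x hx => Function.update_of_ne hx ..
    have hBB : B ≤ B' := fun x => by
      by_cases hx : x = u
      · rw [hx, hB'u]
        exact le_sup_left
      · rw [hB' x hx]
    have hval : IsValid root p B' := fun U hU => by
      by_cases hu : u ∈ U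
      · have hsup : U.sup B' ≤ U.sup B ⊔ Submodule.span F {w} := by
          refine Finset.sup_le fun x hx => ?_
          by_cases hxu : x = u
          · rw [hxu, hB'u]
            exact sup_le_sup_right (Finset.le_sup (f := B) hu) _
          · rw [hB' x hxu]
            exact (Finset.le_sup (f := B) hx).trans le_sup_left
        by_cases hUt : IsTight root p B U
        · rw [sup_eq_left.2 ((Submodule.span_singleton_le_iff_mem _ _).2 (hw U hUt hu))] at hsup
          have := Submodule.finrank_mono hsup
          have := h2 U hU
          omega
        · have e1 := Submodule.finrank_mono hsup
          have e2 := Submodule.finrank_add_le_finrank_add_finrank (U.sup B) (Submodule.span F {w})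
          have e3 := finrank_span_le_card (R := F) ({w} : Set W)
          rw [Set.toFinset_singleton, Finset.card_singleton] at e3
          have e4 := h2 U hU
          have e5 : finrank F ↥(U.sup B) + 1 ≠ U.card := fun hc => hUt ⟨hU, hc⟩
          omega
      · rw [Finset.sup_congr rfl fun x hx => hB' x fun hc => hu (hc ▸ hx)]
        exact h2 U hU
    have htot : IsTight root p B' Finset.univ := hval.isTight isRootedSubtree_univ (by
      have := Submodule.finrank_mono (Finset.sup_mono_fun (s := Finset.univ) fun x _ => hBB x)
      have := h3.2
      omega)
    refine hmin (p, B') ⟨h1, hval, htot, h4.trans hBB⟩ ?_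
    refine Nat.add_lt_add_left (Finset.sum_lt_sum (fun x _ => ?_) ⟨u, Finset.mem_univ u, ?_⟩) _
    · exact Nat.sub_le_sub_left (Submodule.finrank_mono (hBB x)) _
    · have hlt : B u < B' u := by
        refine lt_of_le_of_ne (hBB u) fun hc => hwu ?_
        rw [hc, hB'u]
        exact Submodule.mem_sup_right (Submodule.mem_span_singleton_self w)
      have e1 := Submodule.finrank_lt_finrank_of_lt hlt
      have e2 := Submodule.finrank_le (B' u)
      dsimp only
      omega
  · have hlt := h1.lt (p y) hpy
    refine hmin (Function.update p y (p (p y)), B) ⟨⟨?_, fun x hx => ?_⟩, hv,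
      hv.isTight isRootedSubtree_univ h3.2.ge, h4⟩ ?_
    · dsimp only
      rw [Function.update_of_ne hy.symm, h1.par_root]
    · dsimp only
      by_cases hxy : x = y
      · rw [hxy, Function.update_self]
        exact hlt.trans (h1.lt y hy)
      · rw [Function.update_of_ne hxy]
        exact h1.lt x hx
    · refine Nat.add_lt_add_right (Finset.sum_lt_sum (fun x _ => ?_) ⟨y, Finset.mem_univ y, ?_⟩) _
      · dsimp only
        by_cases hxy : x = y
        · rw [hxy, Function.update_self]
          exact hlt.le
        · rw [Function.update_of_ne hxy]
      · dsimp only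
        rw [Function.update_self]
        exact hlt

end Valid

namespace RTree

variable {V V' : Type} [Fintype V] [DecidableEq V] [Fintype V'] [DecidableEq V']

lemma iterate_depthV (T : RTree V) (v : V) : T.parent^[T.depthV v] v = T.root :=
  Nat.sInf_mem (s := {n : ℕ | T.parent^[n] v = T.root}) (T.reach v)

lemma isRanked (T : RTree V) : IsRanked T.root T.depthV T.parent := by
  refine ⟨T.parent_root, fun v hv => ?_⟩
  have h := T.iterate_depthV v
  cases hn : T.depthV v with
  | zero =>
    rw [hn] at h
    exact absurd h hv
  | succ n =>
    rw [hn] at h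
    exact Nat.lt_succ_of_le (Nat.sInf_le h)

/-- The tree with a given root and parent function. -/
def ofIsRanked {root : V} {ℓ : V → ℕ} {par : V → V} (h : IsRanked root ℓ par) : RTree V where
  root := root
  parent := par
  parent_root := h.par_root
  reach v := h.anc_root v

/-- The tree obtained by relabelling the vertices. -/
def relabel (T : RTree V) (e : V ≃ V') : RTree V' where
  root := e T.root
  parent w := e (T.parent (e.symm w))
  parent_root := by simp [T.parent_root]
  reach w := by
    obtain ⟨n, hn⟩ := T.reach (e.symm w)
    refine ⟨n, ?_⟩
    rw [← hn, ← e.apply_symm_apply w]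
    have : Function.Semiconj e T.parent fun w => e (T.parent (e.symm w)) := fun x => by simp
    rw [← (this.iterate_right n).eq, e.symm_apply_apply]

lemma relabel_root (T : RTree V) (e : V ≃ V') : (T.relabel e).root = e T.root := rfl

lemma relabel_iterate (T : RTree V) (e : V ≃ V') (n : ℕ) (v : V) :
    (T.relabel e).parent^[n] (e v) = e (T.parent^[n] v) := by
  have : Function.Semiconj e T.parent (T.relabel e).parent := fun x => by simp [relabel]
  exact ((this.iterate_right n).eq v).symm

lemma pathEdges_relabel (T : RTree V) (e : V ≃ V') (v : V) :
    (T.relabel e).pathEdges (e v) = e '' T.pathEdges v := by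
  ext w
  obtain ⟨w, rfl⟩ := e.surjective w
  simp [pathEdges, relabel_iterate, relabel_root]

lemma depthV_relabel (T : RTree V) (e : V ≃ V') (v : V) :
    (T.relabel e).depthV (e v) = T.depthV v := by
  simp [depthV, relabel_iterate, relabel_root]

lemma depth_relabel_le (T : RTree V) (e : V ≃ V') : (T.relabel e).depth ≤ T.depth := by
  refine Finset.sup_le fun w _ => ?_
  obtain ⟨v, rfl⟩ := e.surjective w
  rw [depthV_relabel]
  exact Finset.le_sup (f := T.depthV) (Finset.mem_univ v)

lemma pathEdges_root (T : RTree V) : T.pathEdges T.root = ∅ :=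
  Set.eq_empty_of_forall_notMem fun _ hx => hx.1 (T.isRanked.eq_root_of_anc hx.2)

lemma pathEdges_eq_insert (T : RTree V) {v : V} (hv : v ≠ T.root) :
    T.pathEdges v = insert v (T.pathEdges (T.parent v)) := by
  ext x
  constructor
  · rintro ⟨hx, hxv⟩
    exact (Anc.eq_or hxv).imp id fun h => ⟨hx, h⟩
  · rintro (rfl | ⟨hx, hxv⟩)
    · exact ⟨hv, Anc.refl x⟩
    · exact ⟨hx, Anc.trans hxv (Anc.parent v)⟩

lemma pathEdges_mono (T : RTree V) {a v : V} (h : Anc T.parent a v) :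
    T.pathEdges a ⊆ T.pathEdges v := fun _ hx => ⟨hx.1, Anc.trans hx.2 h⟩

lemma exists_isLeaf (T : RTree V) (v : V) : ∃ w, T.IsLeaf w ∧ Anc T.parent v w := by
  obtain ⟨w, hw, hmax⟩ := (down T.parent v).exists_max_image T.depthV ⟨v, by simp [Anc.refl]⟩
  rw [mem_down] at hw
  refine ⟨w, fun u hu => ?_, hw⟩
  by_contra hne
  have hur : u ≠ T.root := fun hc => hne (by rw [← hu, hc, T.parent_root])
  have h1 := T.isRanked.lt u hur
  rw [hu] at h1
  have h2 := hmax u (mem_down.2 (hw.trans (hu ▸ Anc.parent u)))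
  omega

end RTree

section Basis

open Module

variable {F W V ι : Type} [Field F] [AddCommGroup W] [Module F W] [FiniteDimensional F W]
  [Fintype V] [DecidableEq V]

/-- Vectors extending the subspaces along the edges of the tree in an extremal assignment. -/
lemma IsExtremal.exists_span_eq {root : V} {ℓ : V → ℕ} {par : V → V} {A : V → Submodule F W}
    (h : IsExtremal root ℓ par A) : ∃ g : V → W, ∀ u,
      A u = Submodule.span F (g '' (RTree.ofIsRanked h.ranked).pathEdges u) := by
  have hg : ∀ u, ∃ x, u ≠ root → A u = Submodule.span F {x} ⊔ A (par u) := fun u => by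
    by_cases hu : u = root
    · exact ⟨0, fun hc => absurd hu hc⟩
    have e1 := h.finrank_add_one_eq_card_up u
    have e2 := h.finrank_add_one_eq_card_up (par u)
    have e3 := h.ranked.card_up hu
    obtain ⟨x, hx, hxn⟩ : ∃ x ∈ A u, x ∉ A (par u) := by
      by_contra hc
      push Not at hc
      have : finrank F ↥(A u) ≤ finrank F ↥(A (par u)) := Submodule.finrank_mono hc
      omega
    refine ⟨x, fun _ => (Submodule.eq_of_le_of_finrank_le ?_ ?_).symm⟩
    · exact sup_le ((Submodule.span_singleton_le_iff_mem _ _).2 hx) (h.mono_parent u)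
    · have hlt : A (par u) < Submodule.span F {x} ⊔ A (par u) := by
        refine lt_of_le_of_ne le_sup_right fun hc => hxn ?_
        rw [hc]
        exact Submodule.mem_sup_left (Submodule.mem_span_singleton_self x)
      have := Submodule.finrank_lt_finrank_of_lt hlt
      omega
  choose g hg using hg
  refine ⟨g, fun u => ?_⟩
  induction hn : ℓ u using Nat.strong_induction_on generalizing u with
  | _ n ih =>
  subst hn
  by_cases hu : u = root
  · have e1 := h.finrank_add_one_eq_card_up u
    rw [hu, h.ranked.up_root, Finset.card_singleton] at e1
    have hr : (RTree.ofIsRanked h.ranked).pathEdges root = ∅ :=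
      (RTree.ofIsRanked h.ranked).pathEdges_root
    rw [hu, hr, Set.image_empty, Submodule.span_empty]
    exact Submodule.finrank_eq_zero.1 (by omega)
  · rw [RTree.pathEdges_eq_insert (RTree.ofIsRanked h.ranked) hu, Set.image_insert_eq,
      Submodule.span_insert, hg u hu, ih _ (h.ranked.lt u hu) (par u) rfl]
    rfl

omit [FiniteDimensional F W] [DecidableEq V] in
lemma finrank_span_image_le_ncard (g : V → W) (s : Set V) :
    finrank F ↥(Submodule.span F (g '' s)) ≤ s.ncard := by
  classical
  have h := finrank_span_finset_le_card (R := F) (s.toFinset.image g)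
  rw [Finset.coe_image, Set.coe_toFinset] at h
  rw [Set.ncard_eq_toFinset_card']
  exact h.trans Finset.card_image_le

/-- A spanning family with a depth-decomposition has an extended depth-decomposition of at most
the same depth on the same vertex set. -/
theorem exists_extDepthDecomp_of_span_eq_top (v : ι → W)
    (hv : Submodule.span F (Set.range v) = ⊤) (T : RTree V) (f : ι → V)
    (hcard : T.edgeCount = vecRk F v Set.univ)
    (hrk : ∀ X : Set ι, vecRk F v X ≤ (⋃ x ∈ X, T.pathEdges (f x)).ncard) :
    ∃ (T' : RTree V) (f' : ι → V) (g : V → W),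
      IsExtDepthDecomp F v T' f' g ∧ T'.depth ≤ T.depth := by
  have huniv : vecRk F v Set.univ = finrank F W := by
    rw [vecRk, Set.image_univ, hv, finrank_top]
  have hpos : 0 < Fintype.card V := Fintype.card_pos_iff.2 ⟨T.root⟩
  have hcardV : Fintype.card V = finrank F W + 1 := by
    rw [RTree.edgeCount] at hcard
    omega
  let A : V → Submodule F W := fun u => Submodule.span F (v '' {x | f x = u})
  have hAv : ∀ x, v x ∈ A (f x) := fun x => Submodule.subset_span ⟨x, rfl, rfl⟩
  have hvalid : IsValid T.root T.parent A := fun U hU => by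
    have h1 : U.sup A ≤ Submodule.span F (v '' {x | f x ∈ U}) := Finset.sup_le fun u hu =>
      Submodule.span_mono (Set.image_mono fun x hx => by
        rw [Set.mem_ofPred_eq] at hx ⊢
        rwa [hx])
    have h2 := (Submodule.finrank_mono h1).trans (hrk {x | f x ∈ U})
    have h3 : (⋃ x ∈ {x | f x ∈ U}, T.pathEdges (f x)) ⊆ ↑(U.erase T.root) :=
      Set.iUnion₂_subset fun x hx y hy => by
        rw [Finset.mem_coe, Finset.mem_erase]
        exact ⟨hy.1, hU.mem_of_anc hy.2 hx⟩
    have h4 := Set.ncard_le_ncard h3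
    rw [Set.ncard_coe_finset] at h4
    have h5 := Finset.card_erase_add_one hU.1
    omega
  have htop : Finset.univ.sup A = ⊤ := by
    rw [eq_top_iff, ← hv, Submodule.span_le]
    rintro _ ⟨x, rfl⟩
    exact Finset.le_sup (f := A) (Finset.mem_univ (f x)) (hAv x)
  obtain ⟨par, B, hB, hAB⟩ := exists_isExtremal T.isRanked hvalid
    ⟨isRootedSubtree_univ, by rw [htop, finrank_top, Finset.card_univ, hcardV]⟩
  obtain ⟨g, hg⟩ := hB.exists_span_eq
  set T' := RTree.ofIsRanked hB.ranked with hT'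
  choose lf hlf hanc using T'.exists_isLeaf
  have hmem : ∀ x, v x ∈ Submodule.span F (g '' T'.pathEdges (lf (f x))) := fun x =>
    Submodule.span_mono (Set.image_mono (T'.pathEdges_mono (hanc (f x)))) (hg (f x) ▸ hAB _ (hAv x))
  have hspan : Submodule.span F (g '' {u | u ≠ T'.root}) = ⊤ := by
    rw [eq_top_iff, ← hv, Submodule.span_le]
    rintro _ ⟨x, rfl⟩
    exact Submodule.span_mono (Set.image_mono fun u hu => hu.1) (hmem x)
  refine ⟨T', lf ∘ f, g, ⟨⟨fun x => hlf _, hcard, fun X => ?_⟩, ?_, hspan.trans hv.symm, hmem⟩, ?_⟩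
  · refine le_trans (Submodule.finrank_mono (Submodule.span_le.2 ?_))
      (finrank_span_image_le_ncard (F := F) g _)
    rintro _ ⟨x, hx, rfl⟩
    exact Submodule.span_mono (Set.image_mono (Set.subset_biUnion_of_mem
      (u := fun x => T'.pathEdges ((lf ∘ f) x)) hx)) (hmem x)
  · refine linearIndependent_of_top_le_span_of_card_eq_finrank ?_ ?_
    · rw [← hspan, Set.image_eq_range]
      exact le_rfl
    · rw [Fintype.card_subtype_compl, Fintype.card_subtype_eq, hcardV, Nat.add_sub_cancel]
  · exact Finset.sup_le fun u _ => (Nat.sInf_le (hB.ranked.iterate_eq_root _ u le_rfl)).trans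
      (Finset.le_sup (f := T.depthV) (Finset.mem_univ u))

end Basis

/-- Theorem: existence of extended depth-decompositions. Let `(T, f)`
be a depth-decomposition of a vector matroid of depth `d`.  Then there exists an
extended depth-decomposition `(T', f', g)` of the matroid of depth at most `d`. -/
theorem exists_extDepthDecomp (F W ι : Type) [Field F] [AddCommGroup W] [Module F W]
    [Fintype ι] (v : ι → W) {V : Type} [Fintype V] [DecidableEq V]
    (T : RTree V) (f : ι → V)
    (hdd : IsDepthDecompOn (vecRk F v) (vecRk F v Set.univ) T f)
    (d : ℕ) (hd : T.depth = d) :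
    ∃ (nV : ℕ) (T' : RTree (Fin (nV + 1))) (f' : ι → Fin (nV + 1)) (g : Fin (nV + 1) → W),
      IsExtDepthDecomp F v T' f' g ∧ T'.depth ≤ d := by
  subst hd
  obtain ⟨-, hcard, hrk⟩ := hdd
  have hpos : 0 < Fintype.card V := Fintype.card_pos_iff.2 ⟨T.root⟩
  let e : V ≃ Fin (Fintype.card V - 1 + 1) :=
    (Fintype.equivFin V).trans (finCongr (Nat.sub_add_cancel hpos).symm)
  let E := Submodule.span F (Set.range v)
  have : FiniteDimensional F E := FiniteDimensional.span_of_finite F (Set.finite_range v)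
  let v' : ι → E := fun x => ⟨v x, Submodule.subset_span ⟨x, rfl⟩⟩
  have hmap : ∀ X : Set ι, (Submodule.span F (v' '' X)).map E.subtype =
      Submodule.span F (v '' X) := fun X => by
    rw [Submodule.map_span, Set.image_image]
    rfl
  have hvec : vecRk F v' = vecRk F v := by
    funext X
    rw [vecRk, vecRk, ← hmap, Submodule.finrank_map_subtype_eq]
  have htop : Submodule.span F (Set.range v') = ⊤ := by
    apply Submodule.map_injective_of_injective E.injective_subtype
    rw [← Set.image_univ, hmap, Set.image_univ, Submodule.map_top, Submodule.range_subtype]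
  obtain ⟨T', f', g, ⟨⟨h1, h2, h3⟩, h4, h5, h6⟩, h7⟩ :=
    exists_extDepthDecomp_of_span_eq_top (F := F) v' htop (T.relabel e) (e ∘ f)
    (by
      rw [hvec, ← hcard]
      exact congrArg (· - 1) (Fintype.card_congr e).symm)
    (fun X => by
      simp only [Function.comp_apply, RTree.pathEdges_relabel, ← Set.image_iUnion]
      rw [hvec, Set.ncard_image_of_injective _ e.injective]
      exact hrk X)
  have hspan : ∀ s, Submodule.span F ((fun u => (g u : W)) '' s) =
      (Submodule.span F (g '' s)).map E.subtype := fun s => by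
    rw [Submodule.map_span, Set.image_image]
    rfl
  refine ⟨_, T', f', fun u => g u, ⟨⟨h1, hvec ▸ h2, hvec ▸ h3⟩, ?_, ?_, fun x => ?_⟩,
    h7.trans (T.depth_relabel_le e)⟩
  · exact h4.map' E.subtype E.ker_subtype
  · rw [hspan, h5, htop, Submodule.map_top, Submodule.range_subtype]
  · rw [hspan]
    exact ⟨v' x, h6 x, rfl⟩
end

section
/- For any 2-connected graph G, the branch-depth of the graphic matroid M(G) is at least (1/2)·log₂(td(G) − 1), where td(G) is the tree-depth of G. -/
/-- A rooted forest on a finite vertex type `V`, given by its parent function: the roots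
are the fixed points of the parent function, and iterating the parent function from any
vertex reaches a root. -/
structure RForest (V : Type) [Fintype V] [DecidableEq V] where
  parent : V → V
  reach : ∀ v : V, ∃ n : ℕ, parent (parent^[n] v) = parent^[n] v

namespace RForest

variable {V : Type} [Fintype V] [DecidableEq V]

/-- The depth of a vertex: the number of edges on the path from the root of its tree. -/
noncomputable def depthV (Fo : RForest V) (v : V) : ℕ :=
  sInf {n : ℕ | Fo.parent (Fo.parent^[n] v) = Fo.parent^[n] v}

/-- The height of a rooted forest: the maximum number of vertices on a path from a root
to a leaf. -/
noncomputable def height (Fo : RForest V) : ℕ :=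
  Finset.univ.sup fun v => Fo.depthV v + 1

/-- The closure of the rooted forest `Fo` (obtained by adding edges from each vertex to
all its descendants) contains the graph `G` as a subgraph. -/
def ClosureContains (Fo : RForest V) (G : SimpleGraph V) : Prop :=
  ∀ u v : V, G.Adj u v → (∃ n : ℕ, Fo.parent^[n] v = u) ∨ (∃ n : ℕ, Fo.parent^[n] u = v)

end RForest

/-- The tree-depth of a graph `G`: the minimum height of a rooted forest whose closure
contains `G` as a subgraph. -/
noncomputable def treeDepth {V : Type} [Fintype V] [DecidableEq V] (G : SimpleGraph V) : ℕ :=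
  sInf {h : ℕ | ∃ Fo : RForest V, Fo.ClosureContains G ∧ Fo.height = h}

/-- The rank function of the graphic matroid of a graph `G`: the ground set is the edge
set of `G` and the rank of a set of edges is the maximum size of an acyclic subset. -/
noncomputable def graphicRk {V : Type} [Fintype V] [DecidableEq V] (G : SimpleGraph V)
    (S : Set G.edgeSet) : ℕ :=
  sSup {k : ℕ | ∃ S' ⊆ S, (SimpleGraph.fromEdgeSet (Subtype.val '' S')).IsAcyclic ∧
    S'.ncard = k}

/-- The branch-depth of the graphic matroid of a graph `G`. -/
noncomputable def graphicBranchDepth {V : Type} [Fintype V] [DecidableEq V]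
    (G : SimpleGraph V) : ℕ :=
  branchDepth (graphicRk G) (graphicRk G Set.univ)

namespace RTree

variable {W : Type} [Fintype W] [DecidableEq W] (T : RTree W)

lemma iterate_parent_root (n : ℕ) : T.parent^[n] T.root = T.root :=
  Function.iterate_fixed T.parent_root n

lemma iterate_parent_depthV (v : W) : T.parent^[T.depthV v] v = T.root :=
  Nat.sInf_mem (T.reach v)

lemma depthV_iterate_parent {v : W} {n : ℕ} (h : T.parent^[n] v ≠ T.root) :
    T.depthV v = T.depthV (T.parent^[n] v) + n := by
  apply le_antisymm
  · apply Nat.sInf_le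
    simp only [Set.mem_ofPred_eq, Function.iterate_add_apply]
    exact T.iterate_parent_depthV _
  · have hv := T.iterate_parent_depthV v
    have hn : n ≤ T.depthV v := by
      by_contra! hlt
      apply h
      rw [← Nat.sub_add_cancel hlt.le, Function.iterate_add_apply, hv, iterate_parent_root]
    have : T.depthV (T.parent^[n] v) ≤ T.depthV v - n := by
      apply Nat.sInf_le
      simp only [Set.mem_ofPred_eq, ← Function.iterate_add_apply]
      rwa [Nat.sub_add_cancel hn]
    omega

lemma eq_root_of_depthV_eq_zero {v : W} (h : T.depthV v = 0) : v = T.root := by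
  have := T.iterate_parent_depthV v
  rwa [h] at this

lemma depthV_le_depth (v : W) : T.depthV v ≤ T.depth :=
  Finset.le_sup (f := T.depthV) (Finset.mem_univ v)

/-- Among the vertices of `E` on the path from `v` to the root there is a deepest one. -/
lemma exists_pathEdges_inter_subset {v : W} {E : Finset W} (h : ∃ u ∈ E, u ∈ T.pathEdges v) :
    ∃ u ∈ E, u ∈ T.pathEdges v ∧
      ∀ w ∈ E, w ∈ T.pathEdges v → ∀ y, u ∈ T.pathEdges y → w ∈ T.pathEdges y := by
  classical
  have hex : ∃ n, T.parent^[n] v ∈ E ∧ T.parent^[n] v ≠ T.root := by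
    obtain ⟨u, huE, hu, n, rfl⟩ := h
    exact ⟨n, huE, hu⟩
  obtain ⟨hE, hr⟩ := Nat.find_spec hex
  refine ⟨_, hE, ⟨hr, _, rfl⟩, ?_⟩
  rintro w hwE ⟨hw, m, rfl⟩ y ⟨-, k, hk⟩
  have hm : Nat.find hex ≤ m := Nat.find_min' hex ⟨hwE, hw⟩
  refine ⟨hw, m - Nat.find hex + k, ?_⟩
  rw [Function.iterate_add_apply, hk, ← Function.iterate_add_apply, Nat.sub_add_cancel hm]

open Classical in
/-- The elements of `E` lying on a root path of an element of `Z`. -/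
noncomputable def covered {X : Type} (f : X → W) (E : Finset W) (Z : Finset X) : Finset W :=
  {u ∈ E | ∃ x ∈ Z, u ∈ T.pathEdges (f x)}

variable {T} {X : Type} [DecidableEq X] {f : X → W}

/-- For each element of `D`, one edge of the tree can be contracted so that the covering bound for
the subsets of `C ∪ D` not containing `C` is inherited by the proper subsets of `C`. -/
lemma exists_covered_of_union {C : Finset X} (hC : C.Nonempty) (D : Finset X) :
    ∀ E : Finset W, Disjoint C D →
      (∀ Z ⊆ C ∪ D, ¬ C ⊆ Z → Z.card ≤ (T.covered f E Z).card) →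
      ∃ E' ⊆ E, E'.card + D.card = E.card ∧
        ∀ Z ⊆ C, ¬ C ⊆ Z → Z.card ≤ (T.covered f E' Z).card := by
  induction D using Finset.induction_on with
  | empty => exact fun E _ h => ⟨E, subset_rfl, by simp, by simpa using h⟩
  | insert b D hb ih =>
    intro E hdisj h
    have hbC : b ∉ C := fun hbC => Finset.disjoint_left.1 hdisj hbC (Finset.mem_insert_self b D)
    have hbne : ¬ C ⊆ {b} := fun hs => by
      obtain ⟨x, hx⟩ := hC
      exact hbC (Finset.mem_singleton.1 (hs hx) ▸ hx)
    have hpos : 0 < (T.covered f E {b}).card :=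
      (by simp : 0 < ({b} : Finset X).card).trans_le (h {b} (by grind) hbne)
    obtain ⟨u, hu⟩ := Finset.card_pos.1 hpos
    obtain ⟨e, heE, hef, hemax⟩ :=
      T.exists_pathEdges_inter_subset (v := f b) (E := E) ⟨u, by simpa [covered] using hu⟩
    have hE : ∀ Z ⊆ C ∪ D, ¬ C ⊆ Z → Z.card ≤ (T.covered f (E.erase e) Z).card := by
      intro Z hZ hCZ
      by_cases he : ∃ x ∈ Z, e ∈ T.pathEdges (f x)
      · obtain ⟨y, hyZ, hy⟩ := he
        have hbZ : b ∉ Z := fun hbZ => by grind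
        have h1 := h (insert b Z) (by grind) (by grind)
        rw [Finset.card_insert_of_notMem hbZ] at h1
        have h2 : T.covered f E (insert b Z) ⊆ insert e (T.covered f (E.erase e) Z) := by
          intro w hw
          simp only [covered, Finset.mem_filter, Finset.mem_insert, Finset.mem_erase] at hw ⊢
          obtain ⟨hwE, x, rfl | hx, hxw⟩ := hw
          · by_cases hwe : w = e
            · exact Or.inl hwe
            · exact Or.inr ⟨⟨hwe, hwE⟩, y, hyZ, hemax w hwE hxw _ hy⟩
          · by_cases hwe : w = e
            · exact Or.inl hwe
            · exact Or.inr ⟨⟨hwe, hwE⟩, x, hx, hxw⟩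
        have h3 := (Finset.card_le_card h2).trans (Finset.card_insert_le _ _)
        omega
      · refine (h Z (by grind) hCZ).trans (Finset.card_le_card fun w hw => ?_)
        simp only [covered, Finset.mem_filter, Finset.mem_erase] at hw ⊢
        refine ⟨⟨?_, hw.1⟩, hw.2⟩
        rintro rfl
        exact he hw.2
    obtain ⟨E', hE', hcard, hZ⟩ := ih (E.erase e) (by grind) hE
    refine ⟨E', hE'.trans (Finset.erase_subset _ _), ?_, hZ⟩
    rw [Finset.card_insert_of_notMem hb]
    have := Finset.card_erase_add_one heE
    omega

end RTree

namespace RTree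

variable {W : Type} [Fintype W] [DecidableEq W] {T : RTree W} {X : Type} [DecidableEq X]
  {f : X → W}

/-- The number of contracted-tree edges in one level exceeds the number of those closer to the
root by at most one. -/
lemma card_level_le {C : Finset X} {E : Finset W} (hC : E.card + 1 = C.card)
    (h : ∀ Z ⊆ C, ¬ C ⊆ Z → Z.card ≤ (T.covered f E Z).card) (i : ℕ) :
    {w ∈ E | T.depthV w = i}.card ≤ {w ∈ E | T.depthV w < i}.card + 1 := by
  let a : W → W := fun w => T.parent^[T.depthV w - i] w
  let E' : Finset W := {w ∈ E | i ≤ T.depthV w}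
  let C' : Finset X := {x ∈ C | i ≤ T.depthV (f x)}
  let A : Finset W := E'.image a
  have key : ∀ u ∈ A, {w ∈ E' | a w = u}.card + 1 ≤ {x ∈ C' | a (f x) = u}.card := by
    intro u hu
    obtain ⟨w₀, hw₀, rfl⟩ := Finset.mem_image.1 hu
    set Eu := {w ∈ E' | a w = a w₀} with hEu
    set Cu := {x ∈ C' | a (f x) = a w₀} with hCu
    have hEuE : Eu ⊆ E := (Finset.filter_subset _ _).trans (Finset.filter_subset _ _)
    have hCuC : Cu ⊆ C := (Finset.filter_subset _ _).trans (Finset.filter_subset _ _)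
    have hcov : ∀ Z ⊆ C \ Cu, T.covered f E Z ⊆ E \ Eu := by
      intro Z hZ w hw
      simp only [covered, Finset.mem_filter] at hw
      obtain ⟨hwE, x, hx, hwr, n, hn⟩ := hw
      refine Finset.mem_sdiff.2 ⟨hwE, fun hwu => ?_⟩
      have hx := Finset.mem_sdiff.1 (hZ hx)
      obtain ⟨hw', hwa⟩ := Finset.mem_filter.1 hwu
      have hi := (Finset.mem_filter.1 hw').2
      have hd := T.depthV_iterate_parent (v := f x) (n := n) (by rwa [hn])
      rw [hn] at hd
      refine hx.2 (Finset.mem_filter.2 ⟨Finset.mem_filter.2 ⟨hx.1, by omega⟩, ?_⟩)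
      rw [← hwa]
      change T.parent^[T.depthV (f x) - i] (f x) = T.parent^[T.depthV w - i] w
      rw [hd, ← hn, ← Function.iterate_add_apply]
      congr 1
      rw [hn]
      omega
    have hbound : ∀ Z ⊆ C \ Cu, ¬ C ⊆ Z → Z.card + Eu.card ≤ E.card := by
      intro Z hZ hCZ
      have h1 := h Z (hZ.trans Finset.sdiff_subset) hCZ
      have h2 := Finset.card_le_card (hcov Z hZ)
      rw [Finset.card_sdiff_of_subset hEuE] at h2
      have := Finset.card_le_card hEuE
      omega
    have hEpos : 0 < Eu.card := Finset.card_pos.2 ⟨w₀, Finset.mem_filter.2 ⟨hw₀, rfl⟩⟩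
    by_cases hCe : Cu = ∅
    · obtain ⟨x₀, hx₀⟩ : C.Nonempty := Finset.card_pos.1 (by omega)
      have := hbound (C.erase x₀) (by rw [hCe]; grind) (by grind)
      rw [Finset.card_erase_of_mem hx₀] at this
      omega
    · obtain ⟨x, hx⟩ := Finset.nonempty_iff_ne_empty.2 hCe
      have := hbound (C \ Cu) subset_rfl
        (fun hs => (Finset.mem_sdiff.1 (hs (hCuC hx))).2 hx)
      rw [Finset.card_sdiff_of_subset hCuC] at this
      have := Finset.card_le_card hCuC
      omega
  have h1 : E'.card + A.card ≤ C.card := by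
    rw [Finset.card_eq_sum_card_image a E', Finset.card_eq_sum_ones (E'.image a),
      ← Finset.sum_add_distrib]
    refine (Finset.sum_le_sum key).trans ?_
    have : ∑ u ∈ A, {x ∈ C' | a (f x) = u}.card = {x ∈ C' | a (f x) ∈ A}.card := by
      rw [Finset.card_eq_sum_card_fiberwise (f := fun x => a (f x)) (t := A)]
      · refine Finset.sum_congr rfl fun u hu => ?_
        rw [Finset.filter_filter]
        congr 1
        ext x
        grind
      · intro x hx
        exact (Finset.mem_filter.1 hx).2
    rw [this]
    exact Finset.card_le_card ((Finset.filter_subset _ _).trans (Finset.filter_subset _ _))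
  have h2 : E'.card + {w ∈ E | T.depthV w < i}.card = E.card := by
    have := Finset.card_filter_add_card_filter_not (s := E) (fun w => i ≤ T.depthV w)
    simpa only [not_le] using this
  have h3 : {w ∈ E | T.depthV w = i}.card ≤ A.card := by
    refine Finset.card_le_card fun w hw => ?_
    obtain ⟨hwE, rfl⟩ := Finset.mem_filter.1 hw
    exact Finset.mem_image.2 ⟨w, Finset.mem_filter.2 ⟨hwE, le_rfl⟩, by simp [a]⟩
  omega

lemma card_le_two_pow_depth {C : Finset X} {E : Finset W} (hE : T.root ∉ E)
    (hC : E.card + 1 = C.card)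
    (h : ∀ Z ⊆ C, ¬ C ⊆ Z → Z.card ≤ (T.covered f E Z).card) :
    C.card ≤ 2 ^ T.depth := by
  have hlevel : ∀ i, {w ∈ E | T.depthV w < i + 1}.card + 1 ≤ 2 ^ i := by
    intro i
    induction i with
    | zero =>
      have : {w ∈ E | T.depthV w < 0 + 1} = ∅ := by
        refine Finset.filter_eq_empty_iff.2 fun w hw hd => hE ?_
        rwa [← T.eq_root_of_depthV_eq_zero (v := w) (by omega)]
      rw [this]
      simp
    | succ i ih =>
      have h1 := card_level_le hC h (i + 1)
      have h2 : {w ∈ E | T.depthV w < i + 1 + 1} ⊆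
          {w ∈ E | T.depthV w < i + 1} ∪ {w ∈ E | T.depthV w = i + 1} := by
        intro w
        grind
      have h3 := (Finset.card_le_card h2).trans (Finset.card_union_le _ _)
      rw [pow_succ]
      omega
  have hall : {w ∈ E | T.depthV w < T.depth + 1} = E :=
    Finset.filter_true_of_mem fun w _ => Nat.lt_succ_of_le (T.depthV_le_depth w)
  have := hlevel T.depth
  rw [hall] at this
  omega

end RTree

section Graphic

variable {V : Type} {G : SimpleGraph V}

open SimpleGraph

lemma SimpleGraph.Walk.IsPath.isAcyclic_fromEdgeSet {u v : V} {p : G.Walk u v} (hp : p.IsPath) :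
    (fromEdgeSet {e | e ∈ p.edges}).IsAcyclic := by
  induction p with
  | nil => simp
  | @cons u w v h p ih =>
    rw [Walk.cons_isPath_iff] at hp
    have heq : fromEdgeSet {e | e ∈ (Walk.cons h p).edges} =
        fromEdgeSet {e | e ∈ p.edges} ⊔ fromEdgeSet {s(u, w)} := by
      rw [← fromEdgeSet_union]
      congr 1
      ext e
      simp
    rw [heq]
    refine (isAcyclic_add_edge_iff_of_not_reachable u w ?_).2 (ih hp.1)
    rintro ⟨q⟩
    cases q with
    | nil => exact h.ne rfl
    | cons hq _ =>
      rw [fromEdgeSet_adj] at hq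
      exact hp.2 (p.fst_mem_support_of_mem_edges hq.1)

/-- The edges of a cycle extend to a connected spanning subgraph in which every edge set missing
an edge of the cycle is acyclic. -/
lemma SimpleGraph.Walk.IsCycle.exists_unicyclic [Fintype V] (hG : G.Connected) {u : V} {c : G.Walk u u}
    (hc : c.IsCycle) :
    ∃ H ≤ G, (∀ e ∈ c.edges, e ∈ H.edgeSet) ∧ Nat.card H.edgeSet = Fintype.card V ∧
      ∀ e ∈ c.edges, (H.deleteEdges {e}).IsAcyclic := by
  cases c with
  | nil => exact absurd rfl hc.ne_nil
  | @cons u w _ h p =>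
    obtain ⟨hp, hup⟩ := (Walk.cons_isCycle_iff p h).1 hc
    obtain ⟨F, hpF, hFG, hF⟩ := hG.exists_isTree_le_of_le_of_isAcyclic
      (H := fromEdgeSet {e | e ∈ p.edges}) (by
        rw [fromEdgeSet_le]
        rintro e ⟨he, -⟩
        exact p.edges_subset_edgeSet he) hp.isAcyclic_fromEdgeSet
    have hpF' : ∀ e ∈ p.edges, e ∈ F.edgeSet := fun e he => edgeSet_mono hpF (by
      rw [edgeSet_fromEdgeSet]
      exact ⟨he, G.not_isDiag_of_mem_edgeSet (p.edges_subset_edgeSet he)⟩)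
    let H := F ⊔ edge u w
    have hHe : H.edgeSet = insert s(u, w) F.edgeSet := by
      rw [edgeSet_sup, edgeSet_edge_of_ne h.ne, Set.union_comm, Set.insert_eq]
    have hcH : ∀ e ∈ (Walk.cons h p).edges, e ∈ H.edgeSet := by
      intro e he
      rw [hHe]
      rw [Walk.edges_cons, List.mem_cons] at he
      exact he.imp id (hpF' e)
    have hcyc := hc.transfer hcH
    have hnotF : s(u, w) ∉ F.edgeSet := by
      intro huw
      refine hF.isAcyclic _ (hc.transfer (H := F) fun e he => ?_)
      rw [Walk.edges_cons, List.mem_cons] at he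
      rcases he with rfl | he
      · exact huw
      · exact hpF' e he
    have hcard : Nat.card H.edgeSet = Fintype.card V := by
      have hFc := (isTree_iff_connected_and_card.1 hF).2
      rw [Nat.card_eq_fintype_card (α := V)] at hFc
      rw [← hFc, hHe]
      exact Set.ncard_insert_of_notMem hnotF
    refine ⟨H, ?_, hcH, hcard, fun e he => ?_⟩
    · refine sup_le hFG ?_
      rw [← edgeSet_subset_edgeSet, edgeSet_edge_of_ne h.ne]
      simpa using h
    · have hconn : H.Connected := hF.connected.mono le_sup_left
      have hbr : ¬ H.IsBridge e := fun hb =>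
        ((isBridge_iff_forall_cycle_notMem (hcH e he)).1 hb) _ hcyc (by rwa [Walk.edges_transfer])
      induction e with
      | _ x y =>
      have hdel := hconn.connected_delete_edge_of_not_isBridge hbr
      refine (isTree_iff_connected_and_card.2 ⟨hdel, ?_⟩).isAcyclic
      rw [edgeSet_deleteEdges, Nat.card_eq_fintype_card (α := V), ← hcard]
      exact Set.ncard_sdiff_singleton_add_one (hcH _ he)

variable [Fintype V] [DecidableEq V]

lemma Finset.card_le_graphicRk {Z : Finset G.edgeSet} {S : Set G.edgeSet} (hZS : ↑Z ⊆ S)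
    (hZ : (fromEdgeSet (Subtype.val '' (Z : Set G.edgeSet))).IsAcyclic) :
    Z.card ≤ graphicRk G S := by
  refine le_csSup ⟨Nat.card G.edgeSet, ?_⟩ ⟨Z, hZS, hZ, Set.ncard_coe_finset Z⟩
  rintro _ ⟨S', -, -, rfl⟩
  exact Set.ncard_le_card S'

lemma graphicRk_empty : graphicRk G ∅ = 0 := by
  refine Nat.eq_zero_of_le_zero (csSup_le' ?_)
  rintro _ ⟨S', hS', -, rfl⟩
  simp [Set.subset_empty_iff.1 hS']

lemma graphicRk_mono {S S' : Set G.edgeSet} (h : S ⊆ S') : graphicRk G S ≤ graphicRk G S' := by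
  refine csSup_le' ?_
  rintro _ ⟨R, hR, hac, rfl⟩
  have := Finset.card_le_graphicRk (Z := R.toFinite.toFinset) (S := S')
    (by simpa using hR.trans h) (by simpa using hac)
  rwa [← Set.ncard_eq_toFinset_card] at this

lemma graphicRk_add_one_le (hG : G.Connected) (S : Set G.edgeSet) :
    graphicRk G S + 1 ≤ Fintype.card V := by
  obtain ⟨T, hTG, hT⟩ := hG.exists_isTree_le
  have hpos : 0 < Fintype.card V := Fintype.card_pos_iff.2 hG.nonempty
  suffices graphicRk G S ≤ Fintype.card V - 1 by omega
  refine csSup_le' ?_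
  rintro _ ⟨S', -, hac, rfl⟩
  obtain ⟨F, hSF, -, hF⟩ := hG.exists_isTree_le_of_le_of_isAcyclic
    (H := fromEdgeSet (Subtype.val '' S')) (by
      rw [fromEdgeSet_le]
      rintro _ ⟨⟨e, -, rfl⟩, -⟩
      exact e.2) hac
  have hcard := (isTree_iff_connected_and_card.1 hF).2
  rw [Nat.card_eq_fintype_card (α := V)] at hcard
  have hsub : Subtype.val '' S' ⊆ F.edgeSet := by
    rintro _ ⟨e, he, rfl⟩
    refine edgeSet_mono hSF ?_
    rw [edgeSet_fromEdgeSet]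
    exact ⟨⟨e, he, rfl⟩, G.not_isDiag_of_mem_edgeSet e.2⟩
  have := Set.ncard_le_ncard hsub
  rw [Set.ncard_image_of_injective _ Subtype.val_injective] at this
  have h2 : F.edgeSet.ncard = Nat.card F.edgeSet := rfl
  omega

end Graphic

lemma iterate_fin_pred {n : ℕ} (k : ℕ) (v : Fin (n + 1)) :
    ((fun i : Fin (n + 1) => (⟨i - 1, by omega⟩ : Fin (n + 1)))^[k] v : ℕ) = v - k := by
  induction k generalizing v with
  | zero => simp
  | succ k ih =>
    rw [Function.iterate_succ_apply, ih]
    simp only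
    omega

section CycleBound

variable {V : Type} [Fintype V] [DecidableEq V] {G : SimpleGraph V}

open SimpleGraph

/-- A cycle has length at most `2 ^ d` where `d` is the depth of any depth-decomposition of the
graphic matroid. -/
lemma SimpleGraph.Walk.IsCycle.length_le_two_pow_depth (hG : G.Connected) {u : V}
    {c : G.Walk u u} (hc : c.IsCycle) {W : Type} [Fintype W] [DecidableEq W] {T : RTree W}
    {f : G.edgeSet → W} (h : IsDepthDecompOn (graphicRk G) (graphicRk G Set.univ) T f) :
    c.length ≤ 2 ^ T.depth := by
  classical
  obtain ⟨H, hHG, hcH, hcard, hac⟩ := hc.exists_unicyclic hG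
  obtain ⟨-, hcount, hrk⟩ := h
  let C : Finset G.edgeSet := {e | e.1 ∈ c.edges}
  let D : Finset G.edgeSet := {e | e.1 ∈ H.edgeSet ∧ e.1 ∉ c.edges}
  have hdisj : Disjoint C D := by
    rw [Finset.disjoint_left]
    intro e he he'
    exact (Finset.mem_filter.1 he').2.2 (Finset.mem_filter.1 he).2
  have hCmap : C.map ⟨Subtype.val, Subtype.val_injective⟩ = c.edges.toFinset := by
    ext e
    simp only [C, Finset.mem_map, Finset.mem_filter, Finset.mem_univ, true_and,
      Function.Embedding.coeFn_mk, List.mem_toFinset]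
    exact ⟨by rintro ⟨e, he, rfl⟩; exact he,
      fun he => ⟨⟨e, c.edges_subset_edgeSet he⟩, he, rfl⟩⟩
  have hCcard : C.card = c.length := by
    rw [← Finset.card_map, hCmap, List.toFinset_card_of_nodup hc.edges_nodup, Walk.length_edges]
  have hCDimage : Subtype.val '' ((C ∪ D : Finset G.edgeSet) : Set G.edgeSet) = H.edgeSet := by
    ext e
    constructor
    · rintro ⟨e, he, rfl⟩
      rcases Finset.mem_union.1 he with he | he
      · exact hcH _ (Finset.mem_filter.1 he).2
      · exact (Finset.mem_filter.1 he).2.1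
    · intro he
      refine ⟨⟨e, edgeSet_mono hHG he⟩, ?_, rfl⟩
      by_cases hec : e ∈ c.edges
      · exact Finset.mem_union_left _ (Finset.mem_filter.2 ⟨Finset.mem_univ _, hec⟩)
      · exact Finset.mem_union_right _ (Finset.mem_filter.2 ⟨Finset.mem_univ _, he, hec⟩)
  have hCDcard : C.card + D.card = Fintype.card V := by
    rw [← Finset.card_union_of_disjoint hdisj, ← hcard, ← Set.ncard_coe_finset,
      ← Set.ncard_image_of_injective _ Subtype.val_injective, hCDimage]
    rfl
  have hind : ∀ Z ⊆ C ∪ D, ¬ C ⊆ Z →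
      Z.card ≤ (T.covered f (Finset.univ.erase T.root) Z).card := by
    intro Z hZ hCZ
    obtain ⟨e, heC, heZ⟩ := Finset.not_subset.1 hCZ
    have hZac : (fromEdgeSet (Subtype.val '' (Z : Set G.edgeSet))).IsAcyclic := by
      refine (hac e (Finset.mem_filter.1 heC).2).anti ?_
      rw [← edgeSet_subset_edgeSet, edgeSet_fromEdgeSet, edgeSet_deleteEdges, ← hCDimage]
      rintro _ ⟨⟨e', he', rfl⟩, -⟩
      refine ⟨⟨e', hZ he', rfl⟩, fun heq => heZ ?_⟩
      rwa [← Subtype.val_injective heq]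
    refine (Finset.card_le_graphicRk (Set.Subset.refl (Z : Set G.edgeSet)) hZac).trans
      ((hrk _).trans ?_)
    rw [← Set.ncard_coe_finset]
    refine Set.ncard_le_ncard (fun w hw => ?_)
    obtain ⟨x, hx, hwx⟩ := Set.mem_iUnion₂.1 hw
    simp only [RTree.covered, Finset.coe_filter, Finset.mem_erase, Finset.mem_univ, and_true,
      Set.mem_ofPred_eq]
    exact ⟨hwx.1, x, hx, hwx⟩
  have hCpos : 3 ≤ C.card := hCcard ▸ hc.three_le_length
  have hCne : C.Nonempty := Finset.card_pos.1 (by omega)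
  obtain ⟨E, hE, hEcard, hEind⟩ := RTree.exists_covered_of_union hCne D _ hdisj hind
  have hroot : T.root ∉ E := fun hr => (Finset.mem_erase.1 (hE hr)).1 rfl
  rw [Finset.card_erase_of_mem (Finset.mem_univ _), Finset.card_univ] at hEcard
  have hr := graphicRk_add_one_le hG Set.univ
  rw [← hcount, RTree.edgeCount] at hr
  obtain ⟨e, he⟩ := hCne
  have hlow := (hEind (C.erase e) (Finset.erase_subset _ _)
    fun hs => Finset.notMem_erase e C (hs he)).trans
    (Finset.card_le_card (Finset.filter_subset _ _))
  rw [Finset.card_erase_of_mem he] at hlow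
  rw [← hCcard]
  exact RTree.card_le_two_pow_depth hroot (by omega) hEind

/-- The rooted path with `n` edges. -/
def RTree.path (n : ℕ) : RTree (Fin (n + 1)) where
  root := 0
  parent i := ⟨i - 1, by omega⟩
  parent_root := rfl
  reach v := ⟨v, by ext; simp [iterate_fin_pred]⟩

lemma isDepthDecompOn_path {n : ℕ} (hn : graphicRk G Set.univ = n) :
    IsDepthDecompOn (graphicRk G) (graphicRk G Set.univ) (RTree.path n)
      (fun _ => Fin.last n) := by
  refine ⟨fun _ u hu => ?_, by simp [RTree.edgeCount, hn], fun Z => ?_⟩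
  · have := congrArg Fin.val hu
    simp only [RTree.path, Fin.val_last] at this
    ext
    simp only [Fin.val_last]
    omega
  · rcases Z.eq_empty_or_nonempty with rfl | ⟨x, hx⟩
    · simp [graphicRk_empty]
    · have hsub : ((Finset.univ.erase 0 : Finset (Fin (n + 1))) : Set (Fin (n + 1))) ⊆
          ⋃ x ∈ Z, (RTree.path n).pathEdges (Fin.last n) := by
        intro w hw
        refine Set.mem_iUnion₂.2 ⟨x, hx, Finset.ne_of_mem_erase hw, n - w, ?_⟩
        ext
        refine (iterate_fin_pred _ _).trans ?_
        rw [Fin.val_last]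
        omega
      have := Set.ncard_le_ncard hsub
      rw [Set.ncard_coe_finset, Finset.card_erase_of_mem (Finset.mem_univ _), Finset.card_univ,
        Fintype.card_fin, Nat.add_sub_cancel] at this
      exact (graphicRk_mono (Set.subset_univ Z)).trans (hn.le.trans this)

lemma SimpleGraph.Walk.IsCycle.length_le_two_pow_graphicBranchDepth (hG : G.Connected) {u : V}
    {c : G.Walk u u} (hc : c.IsCycle) : c.length ≤ 2 ^ graphicBranchDepth G := by
  obtain ⟨_, T, f, h, hd⟩ := Nat.sInf_mem
    (s := {d : ℕ | ∃ (nV : ℕ) (T : RTree (Fin (nV + 1))) (f : G.edgeSet → Fin (nV + 1)),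
      IsDepthDecompOn (graphicRk G) (graphicRk G Set.univ) T f ∧ T.depth = d})
    ⟨_, _, _, _, isDepthDecompOn_path rfl, rfl⟩
  have := hc.length_le_two_pow_depth hG h
  rwa [hd] at this

end CycleBound

section TwoConnected

variable {V : Type} {G : SimpleGraph V}

open SimpleGraph

namespace SimpleGraph.Walk

lemma IsPath.append_of_inter {u v w : V} {p : G.Walk u v} {q : G.Walk v w} (hp : p.IsPath)
    (hq : q.IsPath) (h : ∀ x ∈ p.support, x ∈ q.support → x = v) : (p.append q).IsPath := by
  rw [isPath_def, support_append, List.nodup_append']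
  refine ⟨hp.support_nodup, hq.support_nodup.tail, fun x hxp hxq => ?_⟩
  obtain rfl := h x hxp (List.mem_of_mem_tail hxq)
  have := hq.support_nodup
  rw [← cons_tail_support] at this
  exact (List.nodup_cons.1 this).1 hxq

lemma IsPath.ne_of_mem_support_tail {u v x : V} {p : G.Walk u v} (hp : p.IsPath)
    (hx : x ∈ p.support.tail) : x ≠ u := by
  rintro rfl
  have := hp.support_nodup
  rw [← cons_tail_support] at this
  exact (List.nodup_cons.1 this).1 hx

/-- Splitting a walk at its first vertex in `s`. -/
lemma exists_append_first_mem {u v : V} (p : G.Walk u v) {s : Set V} (hv : v ∈ s) :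
    ∃ z ∈ s, ∃ (q : G.Walk u z) (r : G.Walk z v), p = q.append r ∧
      ∀ x ∈ q.support, x ∈ s → x = z := by
  induction p with
  | nil => exact ⟨_, hv, nil, nil, rfl, by simp⟩
  | @cons u w v h p ih =>
    by_cases hu : u ∈ s
    · exact ⟨u, hu, nil, cons h p, rfl, by simp⟩
    · obtain ⟨z, hz, q, r, rfl, hqz⟩ := ih hv
      refine ⟨z, hz, cons h q, r, rfl, fun x hx hxs => ?_⟩
      rw [support_cons, List.mem_cons] at hx
      rcases hx with rfl | hx
      · exact absurd hxs hu
      · exact hqz x hx hxs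

end SimpleGraph.Walk

/-- The vertices `u` and `v` are joined by two internally disjoint paths. -/
def SimpleGraph.TwoLinked (G : SimpleGraph V) (u v : V) : Prop :=
  ∃ p q : G.Walk u v, p.IsPath ∧ q.IsPath ∧ 1 < q.length ∧
    ∀ x ∈ p.support, x ∈ q.support → x = u ∨ x = v

lemma SimpleGraph.TwoLinked.exists_isCycle {u v : V} (h : G.TwoLinked u v) :
    ∃ c : G.Walk u u, c.IsCycle ∧ v ∈ c.support := by
  obtain ⟨p, q, hp, hq, hlen, hpq⟩ := h
  refine ⟨p.append q.reverse, hp.isCycle_append hq.reverse ?_ (Or.inr (by simpa)), by simp⟩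
  intro x hxp hxq
  have hxu := hp.ne_of_mem_support_tail hxp
  have hxv := hq.reverse.ne_of_mem_support_tail hxq
  have hxq' : x ∈ q.support := by simpa using List.mem_of_mem_tail hxq
  rcases hpq x (List.mem_of_mem_tail hxp) hxq' with h | h
  · exact hxu h
  · exact hxv h

lemma SimpleGraph.exists_walk_avoiding
    (hdel : ∀ v : V, (G.induce ({v}ᶜ : Set V)).Connected) {u v w : V} (hu : u ≠ w)
    (hv : v ≠ w) : ∃ p : G.Walk u v, w ∉ p.support := by
  have hu' : u ∈ ({w}ᶜ : Set V) := hu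
  have hv' : v ∈ ({w}ᶜ : Set V) := hv
  obtain ⟨p⟩ := (hdel w).preconnected ⟨u, hu'⟩ ⟨v, hv'⟩
  have hp : w ∉ (p.map (Embedding.induce _).toHom).support := by
    rw [Walk.support_map, List.mem_map]
    rintro ⟨x, -, hx⟩
    exact x.2 hx
  exact ⟨_, hp⟩

/-- Extending two internally disjoint `u`-`w` paths to a neighbor of `w`, using a path that meets
the first of them first. -/
lemma SimpleGraph.TwoLinked.of_adj_aux {u v w z : V} (huw : u ≠ w) (hvw : G.Adj w v)
    {p q : G.Walk u w} (hp : p.IsPath) (hq : q.IsPath)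
    (hpq : ∀ x ∈ p.support, x ∈ q.support → x = u ∨ x = w)
    {r : G.Walk v z} (hr : r.IsPath) (hrw : w ∉ r.support) (hvu : v ≠ u) (hz : z ∈ p.support)
    (hrp : ∀ x ∈ r.support, x ∈ p.support → x = z)
    (hrq : ∀ x ∈ r.support, x ∈ q.support → x = z) : G.TwoLinked u v := by
  classical
  have hzw : z ≠ w := by
    rintro rfl
    exact hrw r.end_mem_support
  have hvq : v ∉ q.support := by
    intro hvq
    obtain rfl := hrq v r.start_mem_support hvq
    rcases hpq _ hz hvq with h | h
    · exact hvu h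
    · exact hzw h
  have hwp : w ∉ (p.takeUntil z hz).support := p.endpoint_notMem_support_takeUntil hp hz hzw.symm
  refine ⟨(p.takeUntil z hz).append r.reverse, q.concat hvw, ?_, hq.concat hvq hvw, ?_, ?_⟩
  · refine (hp.takeUntil hz).append_of_inter hr.reverse fun x hx hxr => ?_
    exact hrp x (by simpa using hxr) (p.support_takeUntil_subset_support hz hx)
  · rw [Walk.length_concat]
    have : q.length ≠ 0 := fun h => huw (Walk.eq_of_length_eq_zero h)
    omega
  · intro x hx hxq
    rw [Walk.support_concat, List.mem_append, List.mem_singleton] at hxq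
    rcases hxq with hxq | rfl
    · left
      rw [Walk.mem_support_append_iff, Walk.support_reverse, List.mem_reverse] at hx
      rcases hx with hx | hx
      · refine (hpq x (p.support_takeUntil_subset_support hz hx) hxq).resolve_right ?_
        rintro rfl
        exact hwp hx
      · obtain rfl := hrq x hx hxq
        exact (hpq _ hz hxq).resolve_right hzw
    · exact Or.inr rfl

lemma SimpleGraph.TwoLinked.of_adj (hdel : ∀ v : V, (G.induce ({v}ᶜ : Set V)).Connected)
    {u v w : V} (huw : u ≠ w) (hvw : G.Adj w v) (hvu : v ≠ u) (h : G.TwoLinked u w) :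
    G.TwoLinked u v := by
  obtain ⟨p, q, hp, hq, -, hpq⟩ := h
  obtain ⟨r₀, hr₀⟩ := exists_walk_avoiding hdel hvw.ne' huw
  classical
  obtain ⟨z, hz, r, r', hrr, hrz⟩ :=
    r₀.bypass.exists_append_first_mem (s := {x | x ∈ p.support ∨ x ∈ q.support})
      (Or.inl p.start_mem_support)
  have hr : r.IsPath := (hrr ▸ r₀.bypass_isPath).of_append_left
  have hrw : w ∉ r.support := fun h => hr₀ <| r₀.support_bypass_subset_support <|
    hrr ▸ Walk.support_subset_support_append_left r r' h
  rcases hz with hz | hz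
  · exact .of_adj_aux huw hvw hp hq hpq hr hrw hvu hz (fun x hx h => hrz x hx (Or.inl h))
      (fun x hx h => hrz x hx (Or.inr h))
  · exact .of_adj_aux huw hvw hq hp (fun x h h' => hpq x h' h) hr hrw hvu hz
      (fun x hx h => hrz x hx (Or.inr h)) (fun x hx h => hrz x hx (Or.inl h))

lemma SimpleGraph.TwoLinked.of_adj_self [Fintype V] [DecidableEq V]
    (hcard : 3 ≤ Fintype.card V) (hdel : ∀ v : V, (G.induce ({v}ᶜ : Set V)).Connected)
    {u v : V} (huv : G.Adj u v) : G.TwoLinked u v := by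
  obtain ⟨t, ht⟩ : ∃ t, t ∉ ({u, v} : Finset V) := by
    by_contra! hall
    have := Finset.card_le_card (fun x _ => hall x : Finset.univ ⊆ {u, v})
    have := Finset.card_le_two (a := u) (b := v)
    rw [Finset.card_univ] at *
    omega
  simp only [Finset.mem_insert, Finset.mem_singleton, not_or] at ht
  obtain ⟨p, hp⟩ := exists_walk_avoiding hdel huv.ne ht.2
  obtain ⟨q, hq⟩ := exists_walk_avoiding hdel ht.1 huv.ne'
  have huvnot : s(u, v) ∉ (p.append q).bypass.edges := by
    intro h
    have := Walk.edges_bypass_subset_edges _ h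
    rw [Walk.edges_append, List.mem_append] at this
    rcases this with h | h
    · exact hp (p.snd_mem_support_of_mem_edges h)
    · exact hq (q.fst_mem_support_of_mem_edges h)
  refine ⟨huv.toWalk, (p.append q).bypass, .of_adj huv, Walk.bypass_isPath _, ?_, by simp⟩
  generalize (p.append q).bypass = r at huvnot
  match r with
  | .nil => exact absurd rfl huv.ne
  | .cons _ .nil => simp at huvnot
  | .cons _ (.cons _ _) => simp

/-- Any two vertices of a `2`-connected graph lie on a common cycle. -/
lemma SimpleGraph.twoLinked_of_twoConnected [Fintype V] [DecidableEq V]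
    (hcard : 3 ≤ Fintype.card V) (hconn : G.Connected)
    (hdel : ∀ v : V, (G.induce ({v}ᶜ : Set V)).Connected) {u v : V} (huv : v ≠ u) :
    G.TwoLinked u v := by
  obtain ⟨p⟩ := hconn.preconnected v u
  induction p with
  | nil => exact absurd rfl huv
  | @cons v w u h p ih =>
    by_cases hwu : w = u
    · subst hwu
      exact .of_adj_self hcard hdel h.symm
    · exact (ih hwu).of_adj hdel (Ne.symm hwu) h.symm huv

/-- A path between two vertices of a cycle `c` that meets `c` in its ends only is no longer than
the longest cycle. -/
lemma SimpleGraph.Walk.IsPath.length_le_of_ear {k : ℕ}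
    (hk : ∀ (u : V) (c : G.Walk u u), c.IsCycle → c.length ≤ k) {u a z : V} {c : G.Walk u u}
    (hc : c.IsCycle) (ha : a ∈ c.support) (hz : z ∈ c.support) {s : G.Walk a z}
    (hs : s.IsPath) (h : ∀ x ∈ s.support.tail, x ∈ c.support → x = z) : s.length ≤ k := by
  classical
  by_cases h1 : s.length ≤ 1
  · have := hc.three_le_length.trans (hk _ _ hc)
    omega
  have hz' : z ∈ (c.rotate a ha).support := (c.mem_support_rotate_iff a ha).2 hz
  have hp : ((c.rotate a ha).takeUntil z hz').IsPath := (hc.rotate ha).isPath_takeUntil hz'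
  have hcyc := hs.isCycle_append hp.reverse (fun x hx hxp => ?_) (Or.inl (by omega))
  · have := hk _ _ hcyc
    rw [length_append] at this
    omega
  · refine hp.reverse.ne_of_mem_support_tail hxp (h x hx ?_)
    have := List.mem_of_mem_tail hxp
    rw [support_reverse, List.mem_reverse] at this
    exact (c.mem_support_rotate_iff a ha).1 (support_takeUntil_subset_support _ hz' this)

/-- If all cycles have length at most `k`, then a path between two vertices of a cycle `c` splits
into segments of length at most `k` between its vertices on `c`. -/
lemma SimpleGraph.Walk.IsPath.length_le_mul_countP [DecidableEq V] {k : ℕ}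
    (hk : ∀ (u : V) (c : G.Walk u u), c.IsCycle → c.length ≤ k) {u : V} {c : G.Walk u u}
    (hc : c.IsCycle) {a b : V} (ha : a ∈ c.support) (hb : b ∈ c.support) {p : G.Walk a b}
    (hp : p.IsPath) : p.length ≤ k * p.support.countP (· ∈ c.support) := by
  induction hn : p.length using Nat.strong_induction_on generalizing a p with
  | _ n ih =>
  cases p with
  | nil => simp at hn; omega
  | @cons a w _ h p =>
    obtain ⟨z, hz, q, r, rfl, hqz⟩ := p.exists_append_first_mem (s := {x | x ∈ c.support}) hb
    rw [← cons_append] at hp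
    have hq : (cons h q).length ≤ k := hp.of_append_left.length_le_of_ear hk hc ha hz hqz
    have hr := ih r.length (by simp at hn; omega) hz hp.of_append_right rfl
    have hcount : r.support.countP (· ∈ c.support) ≤ (q.append r).support.countP (· ∈ c.support) :=
      (q.support_suffix_support_append r).sublist.countP_le
    rw [← hn, support_cons, List.countP_cons_of_pos (by simpa using ha), mul_add, mul_one]
    have := hr.trans (Nat.mul_le_mul_left k hcount)
    rw [← cons_append, length_append]
    omega

/-- In a `2`-connected graph whose cycles have length at most `k`, all paths have length at most
`k * k`. -/
lemma SimpleGraph.Walk.IsPath.length_le_mul_self [Fintype V] [DecidableEq V] {k : ℕ}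
    (hcard : 3 ≤ Fintype.card V) (hconn : G.Connected)
    (hdel : ∀ v : V, (G.induce ({v}ᶜ : Set V)).Connected)
    (hk : ∀ (u : V) (c : G.Walk u u), c.IsCycle → c.length ≤ k) {a b : V} {p : G.Walk a b}
    (hp : p.IsPath) : p.length ≤ k * k := by
  by_cases hab : b = a
  · subst hab
    rw [length_eq_zero_iff.2 (isPath_iff_nil.1 hp)]
    exact Nat.zero_le _
  obtain ⟨c, hc, hbc⟩ := (twoLinked_of_twoConnected hcard hconn hdel hab).exists_isCycle
  refine (hp.length_le_mul_countP hk hc c.start_mem_support hbc).trans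
    (Nat.mul_le_mul_left k (le_trans ?_ (hk _ c hc)))
  have hsub : p.support.filter (· ∈ c.support) ⊆ c.support.tail := fun x hx => by
    have hx : x ∈ c.support := by simpa using (List.mem_filter.1 hx).2
    rw [← cons_tail_support, List.mem_cons] at hx
    rcases hx with rfl | hx
    · exact end_mem_tail_support hc.not_nil
    · exact hx
  have := ((hp.support_nodup.filter _).subperm hsub).length_le
  rw [List.countP_eq_length_filter]
  simpa using this

end TwoConnected

section TreeDepth

variable {V : Type} {G : SimpleGraph V}

open SimpleGraph

/-- The function `σ` lists the strict ancestors of the vertices of `S`, nearest first, in a rooted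
forest on `S` whose closure contains the subgraph of `G` induced by `S`. -/
structure SimpleGraph.IsAncestry (G : SimpleGraph V) (S : Finset V) (σ : V → List V) : Prop where
  tail : ∀ v ∈ S, ∀ w t, σ v = w :: t → w ∈ S ∧ σ w = t
  adj : ∀ u ∈ S, ∀ v ∈ S, G.Adj u v → u ∈ σ v ∨ v ∈ σ u

/-- Depth-first search: if every vertex of `S` is reached within `S` from the set `R`, and every
path within `S` starting in `R` has length less than `k`, then there is a forest of height at
most `k` on `S` whose closure contains the subgraph induced by `S`. -/
lemma SimpleGraph.exists_isAncestry [DecidableEq V] (n : ℕ) :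
    ∀ (S : Finset V), S.card ≤ n → ∀ (R : Set V) (k : ℕ),
      (∀ v ∈ S, ∃ r ∈ R, ∃ p : G.Walk r v, ∀ x ∈ p.support, x ∈ S) →
      (∀ r ∈ R, ∀ (v : V) (p : G.Walk r v), p.IsPath → (∀ x ∈ p.support, x ∈ S) → p.length < k) →
      ∃ σ : V → List V, G.IsAncestry S σ ∧ ∀ v ∈ S, (σ v).length < k := by
  classical
  induction n with
  | zero =>
    intro S hS R k _ _
    obtain rfl : S = ∅ := by simpa using hS
    exact ⟨fun _ => [], ⟨by simp, by simp⟩, by simp⟩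
  | succ n ih =>
    intro S hS R k hreach hlen
    rcases S.eq_empty_or_nonempty with rfl | ⟨v₀, hv₀⟩
    · exact ⟨fun _ => [], ⟨by simp, by simp⟩, by simp⟩
    obtain ⟨y, hyR, p₀, hp₀⟩ := hreach v₀ hv₀
    have hyS : y ∈ S := hp₀ y p₀.start_mem_support
    set K := S.filter fun v => ∃ p : G.Walk y v, ∀ x ∈ p.support, x ∈ S with hK
    have hKS : K ⊆ S := Finset.filter_subset _ _
    have hyK : y ∈ K := Finset.mem_filter.2 ⟨hyS, .nil, by simpa using hyS⟩
    have hKadj : ∀ u ∈ K, ∀ v ∈ S, G.Adj u v → v ∈ K := by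
      intro u hu v hv huv
      obtain ⟨-, p, hp⟩ := Finset.mem_filter.1 hu
      refine Finset.mem_filter.2 ⟨hv, p.concat huv, fun x hx => ?_⟩
      rw [Walk.support_concat, List.mem_append, List.mem_singleton] at hx
      rcases hx with hx | rfl
      · exact hp x hx
      · exact hv
    have hkpos : 0 < k := hlen y hyR y .nil .nil (by simpa using hyS)
    obtain ⟨σ₁, h₁, hl₁⟩ := ih (K.erase y)
      (by have := Finset.card_erase_lt_of_mem hyK; have := Finset.card_le_card hKS; omega)
      {r | G.Adj y r} (k - 1)
      (by
        intro v hv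
        obtain ⟨hvy, hvK⟩ := Finset.mem_erase.1 hv
        obtain ⟨hvS, p, hp⟩ := Finset.mem_filter.1 hvK
        have hq : ∀ x ∈ p.bypass.support, x ∈ S := fun x hx =>
          hp x (p.support_bypass_subset_support hx)
        have hqp := p.bypass_isPath
        generalize p.bypass = q at hq hqp
        cases q with
        | nil => exact absurd rfl hvy
        | @cons _ r _ h q =>
          rw [Walk.cons_isPath_iff] at hqp
          refine ⟨r, h, q, fun x hx => Finset.mem_erase.2 ⟨?_, Finset.mem_filter.2 ⟨?_, ?_⟩⟩⟩
          · rintro rfl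
            exact hqp.2 hx
          · exact hq x (by simp [hx])
          · refine ⟨.cons h (q.takeUntil x hx), fun z hz => hq z ?_⟩
            rw [Walk.support_cons, List.mem_cons] at hz ⊢
            exact hz.imp_right fun hz => q.support_takeUntil_subset_support hx hz)
      (by
        intro r hr v p hp hpK
        have := hlen y hyR v (.cons hr p)
          (hp.cons fun hy => (Finset.mem_erase.1 (hpK y hy)).1 rfl)
          (fun x hx => by
            rw [Walk.support_cons, List.mem_cons] at hx
            rcases hx with rfl | hx
            · exact hyS
            · exact hKS (Finset.mem_of_mem_erase (hpK x hx)))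
        rw [Walk.length_cons] at this
        omega)
    obtain ⟨σ₂, h₂, hl₂⟩ := ih (S \ K)
      (by
        have := Finset.card_sdiff_add_card_eq_card hKS
        have := Finset.card_pos.2 ⟨y, hyK⟩
        omega)
      R k
      (by
        intro v hv
        obtain ⟨hvS, hvK⟩ := Finset.mem_sdiff.1 hv
        obtain ⟨r, hr, p, hp⟩ := hreach v hvS
        refine ⟨r, hr, p, fun x hx => Finset.mem_sdiff.2 ⟨hp x hx, fun hxK => hvK ?_⟩⟩
        obtain ⟨-, q, hq⟩ := Finset.mem_filter.1 hxK
        refine Finset.mem_filter.2 ⟨hvS, q.append (p.dropUntil x hx), fun z hz => ?_⟩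
        rw [Walk.mem_support_append_iff] at hz
        rcases hz with hz | hz
        · exact hq z hz
        · exact hp z (p.support_dropUntil_subset_support hx hz))
      (fun r hr v p hp hpS => hlen r hr v p hp fun x hx => (Finset.mem_sdiff.1 (hpS x hx)).1)
    set σ : V → List V := fun v => if v = y then [] else if v ∈ K then σ₁ v ++ [y] else σ₂ v
    have hσy : σ y = [] := if_pos rfl
    have hσK : ∀ v ∈ K.erase y, σ v = σ₁ v ++ [y] := fun v hv => by
      simp [σ, (Finset.mem_erase.1 hv).1, (Finset.mem_erase.1 hv).2]
    have hσS : ∀ v ∈ S \ K, σ v = σ₂ v := fun v hv => by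
      have hvK := (Finset.mem_sdiff.1 hv).2
      simp [σ, hvK, show v ≠ y by rintro rfl; exact hvK hyK]
    have hcases : ∀ v ∈ S, v = y ∨ v ∈ K.erase y ∨ v ∈ S \ K := fun v hv => by
      simp only [Finset.mem_erase, Finset.mem_sdiff]
      tauto
    refine ⟨σ, ⟨?_, ?_⟩, ?_⟩
    · intro v hv w t hvw
      rcases hcases v hv with rfl | hv | hv
      · simp [hσy] at hvw
      · rw [hσK v hv] at hvw
        match hv₁ : σ₁ v with
        | [] =>
          simp only [hv₁, List.nil_append, List.cons.injEq] at hvw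
          obtain ⟨rfl, rfl⟩ := hvw
          exact ⟨hyS, hσy⟩
        | w' :: t' =>
          simp only [hv₁, List.cons_append, List.cons.injEq] at hvw
          obtain ⟨rfl, rfl⟩ := hvw
          obtain ⟨hw, hwt⟩ := h₁.tail v hv _ _ hv₁
          exact ⟨hKS (Finset.mem_of_mem_erase hw), by rw [hσK _ hw, hwt]⟩
      · rw [hσS v hv] at hvw
        obtain ⟨hw, hwt⟩ := h₂.tail v hv _ _ hvw
        exact ⟨Finset.sdiff_subset hw, by rw [hσS _ hw, hwt]⟩
    · intro u hu v hv huv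
      rcases hcases u hu with rfl | hu' | hu' <;> rcases hcases v hv with rfl | hv' | hv'
      · exact absurd rfl huv.ne
      · simp [hσK v hv']
      · exact absurd (hKadj _ hyK v hv huv) (Finset.mem_sdiff.1 hv').2
      · simp [hσK u hu']
      · rw [hσK u hu', hσK v hv']
        exact (h₁.adj u hu' v hv' huv).imp (List.mem_append_left _) (List.mem_append_left _)
      · exact absurd (hKadj u (Finset.mem_of_mem_erase hu') v hv huv) (Finset.mem_sdiff.1 hv').2
      · exact absurd (hKadj _ hyK u hu huv.symm) (Finset.mem_sdiff.1 hu').2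
      · exact absurd (hKadj v (Finset.mem_of_mem_erase hv') u hu huv.symm)
          (Finset.mem_sdiff.1 hu').2
      · rw [hσS u hu', hσS v hv']
        exact h₂.adj u hu' v hv' huv
    · intro v hv
      rcases hcases v hv with rfl | hv | hv
      · simpa [hσy] using hkpos
      · have := hl₁ v hv
        simp only [hσK v hv, List.length_append, List.length_singleton]
        omega
      · simpa [hσS v hv] using hl₂ v hv

/-- The tree-depth of a graph is at most one more than the length of its longest path. -/
lemma treeDepth_le_of_forall_isPath_length_le [Fintype V] [DecidableEq V] {N : ℕ}
    (hN : ∀ (u v : V) (p : G.Walk u v), p.IsPath → p.length ≤ N) : treeDepth G ≤ N + 1 := by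
  obtain ⟨σ, hσ, hlen⟩ := G.exists_isAncestry _ Finset.univ le_rfl Set.univ (N + 1)
    (fun v _ => ⟨v, trivial, .nil, by simp⟩)
    (fun r _ v p hp _ => Nat.lt_succ_of_le (hN r v p hp))
  set parent : V → V := fun v => (σ v).headD v
  have hnil : ∀ v, σ v = [] → parent v = v := fun v hv => by simp [parent, hv]
  have hiter : ∀ n v, (σ v).length = n → parent (parent^[n] v) = parent^[n] v := by
    intro n
    induction n with
    | zero => exact fun v hv => hnil v (List.length_eq_zero_iff.1 hv)
    | succ n ih =>
      intro v hv
      obtain ⟨w, t, hwt⟩ := List.exists_cons_of_length_eq_add_one hv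
      have hw : parent v = w := by simp [parent, hwt]
      rw [Function.iterate_succ_apply, hw]
      exact ih w (by rw [(hσ.tail v (Finset.mem_univ _) w t hwt).2]; simpa [hwt] using hv)
  have hmem : ∀ n u v, (σ v).length = n → u ∈ σ v → ∃ m, parent^[m] v = u := by
    intro n
    induction n with
    | zero => exact fun u v hv hu => by simp [List.length_eq_zero_iff.1 hv] at hu
    | succ n ih =>
      intro u v hv hu
      obtain ⟨w, t, hwt⟩ := List.exists_cons_of_length_eq_add_one hv
      have hw : parent v = w := by simp [parent, hwt]
      have ht := (hσ.tail v (Finset.mem_univ _) w t hwt).2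
      rw [hwt, List.mem_cons] at hu
      rcases hu with rfl | hu
      · exact ⟨1, hw⟩
      · obtain ⟨m, hm⟩ := ih u w (by rw [ht]; simpa [hwt] using hv) (ht ▸ hu)
        exact ⟨m + 1, by rw [Function.iterate_succ_apply, hw, hm]⟩
  let Fo : RForest V := ⟨parent, fun v => ⟨_, hiter _ v rfl⟩⟩
  have hheight : Fo.height ≤ N + 1 := Finset.sup_le fun v _ =>
    (Nat.add_le_add_right (Nat.sInf_le (hiter _ v rfl)) 1).trans (hlen v (Finset.mem_univ _))
  refine le_trans (Nat.sInf_le ⟨Fo, fun u v huv => ?_, rfl⟩) hheight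
  exact (hσ.adj u (Finset.mem_univ _) v (Finset.mem_univ _) huv).imp
    (hmem _ u v rfl) (hmem _ v u rfl)

end TreeDepth

/-- Proposition: lower bound on `bd(M(G))` for `2`-connected graphs.
For any `2`-connected graph `G` (a graph with at least three vertices that is connected
and stays connected after the removal of any single vertex), the branch-depth of the
graphic matroid `M(G)` is at least `(1/2) · log₂ (td(G) - 1)`. -/
theorem graphic_branchDepth_ge_of_twoConnected (V : Type) [Fintype V] [DecidableEq V]
    (G : SimpleGraph V)
    (hcard : 3 ≤ Fintype.card V) (hconn : G.Connected)
    (hdel : ∀ v : V, (G.induce ({v}ᶜ : Set V)).Connected) :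
    (1 / 2 : ℝ) * Real.logb 2 ((treeDepth G : ℝ) - 1) ≤ (graphicBranchDepth G : ℝ) := by
  have htd : treeDepth G ≤ 2 ^ (2 * graphicBranchDepth G) + 1 := by
    rw [two_mul, pow_add]
    exact treeDepth_le_of_forall_isPath_length_le fun u v p hp =>
      hp.length_le_mul_self hcard hconn hdel fun u c hc =>
        hc.length_le_two_pow_graphicBranchDepth hconn
  rcases Nat.lt_or_ge (treeDepth G) 2 with h | h
  · have : Real.logb 2 ((treeDepth G : ℝ) - 1) = 0 := by
      generalize treeDepth G = t at h
      interval_cases t <;> simp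
    rw [this, mul_zero]
    positivity
  · have hpos : (0 : ℝ) < (treeDepth G : ℝ) - 1 := by
      have : (2 : ℝ) ≤ treeDepth G := by exact_mod_cast h
      linarith
    have hle : (treeDepth G : ℝ) - 1 ≤ 2 ^ (2 * graphicBranchDepth G) := by
      have : (treeDepth G : ℝ) ≤ 2 ^ (2 * graphicBranchDepth G) + 1 := by exact_mod_cast htd
      linarith
    have := Real.logb_le_logb_of_le one_lt_two hpos hle
    rw [Real.logb_pow, Real.logb_self_eq_one one_lt_two] at this
    push_cast at this
    linarith
end
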